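/- arXiv:1401.4853 — 2 statements merged into one kernel-verified Lean document; each statement's English description precedes it below -/
import Mathlib

section
/- ∫_{ℝ^n_+} e^{-‖σ‖²/2} ∏_{1≤i<j≤n} |σ_i² - σ_j²| dσ = (2^{n²/2}/π^{n/2}) ∏_{j=1}^n Γ(j/2)Γ(j/2+1). -/
open Finset Real MeasureTheory

namespace SelAux

noncomputable def D {n : ℕ} (σ : Fin n → ℝ) : ℝ :=
  ∏ p ∈ Finset.univ.filter (fun p : Fin n × Fin n => p.1 < p.2), |σ p.1 ^ 2 - σ p.2 ^ 2|

def orth (n : ℕ) : Set (Fin n → ℝ) := {σ | ∀ i, 0 < σ i}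

lemma D_eq {n : ℕ} (σ : Fin n → ℝ) :
    D σ = |(Matrix.vandermonde (fun i => σ i ^ 2)).det| := by
  rw [Matrix.det_vandermonde, Finset.abs_prod, D, Finset.prod_filter, ← Finset.univ_product_univ,
    Finset.prod_product]
  refine Finset.prod_congr rfl fun i _ => ?_
  rw [Finset.abs_prod, ← Finset.prod_filter]
  refine Finset.prod_congr ?_ fun j _ => abs_sub_comm _ _
  ext j; simp

lemma D_perm {n : ℕ} (σ : Fin n → ℝ) (e : Equiv.Perm (Fin n)) : D (fun i => σ (e i)) = D σ := by
  rw [D_eq, D_eq]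
  have := Matrix.det_permute e (Matrix.vandermonde (fun i => σ i ^ 2))
  have h2 : (Matrix.vandermonde (fun i => σ i ^ 2)).submatrix e id
      = Matrix.vandermonde (fun i => σ (e i) ^ 2) := by
    ext i j; simp [Matrix.vandermonde]
  rw [h2] at this
  rw [this, abs_mul]
  rcases Int.units_eq_one_or (Equiv.Perm.sign e) with h | h <;> simp [h]

lemma D_cons {n : ℕ} (x : ℝ) (y : Fin n → ℝ) :
    D (Fin.cons x y : Fin (n+1) → ℝ) = (∏ j, |x ^ 2 - y j ^ 2|) * D y := by
  have key : ∀ {m : ℕ} (σ : Fin m → ℝ), D σ = ∏ i, ∏ j ∈ Finset.Ioi i, |σ i ^ 2 - σ j ^ 2| := by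
    intro m σ
    rw [D, Finset.prod_filter, ← Finset.univ_product_univ, Finset.prod_product]
    refine Finset.prod_congr rfl fun i _ => ?_
    rw [← Finset.prod_filter]
    refine Finset.prod_congr ?_ fun j _ => rfl
    ext j; simp
  rw [key, key, Fin.prod_univ_succ]
  congr 1
  · rw [Fin.prod_Ioi_zero]; simp
  · refine Finset.prod_congr rfl fun i _ => ?_
    rw [Fin.prod_Ioi_succ]; simp

lemma D_insertNth {n : ℕ} (i : Fin (n+1)) (x : ℝ) (y : Fin n → ℝ) :
    D (i.insertNth x y : Fin (n+1) → ℝ) = (∏ j, |x ^ 2 - y j ^ 2|) * D y := by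
  rw [← D_cons, ← D_perm _ i.cycleRange.symm]
  congr 1
  ext j
  exact Fin.insertNth_apply_cycleRange_symm i x y j

lemma D_nonneg {n : ℕ} (σ : Fin n → ℝ) : 0 ≤ D σ := Finset.prod_nonneg fun _ _ => abs_nonneg _

lemma measurableSet_orth (n : ℕ) : MeasurableSet (orth n) := by
  have : orth n = ⋂ i, {σ : Fin n → ℝ | 0 < σ i} := by ext; simp [orth]
  rw [this]
  exact MeasurableSet.iInter fun i => measurableSet_lt measurable_const (measurable_pi_apply i)

lemma integral_perm {n : ℕ} (e : Equiv.Perm (Fin n)) (f : (Fin n → ℝ) → ℝ) :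
    ∫ σ in orth n, f (fun i => σ (e i)) = ∫ σ in orth n, f σ := by
  have h := volume_measurePreserving_piCongrLeft (fun _ : Fin n => ℝ) e.symm
  have h2 := h.setIntegral_preimage_emb (MeasurableEquiv.measurableEmbedding _) f (orth n)
  rw [← h2]
  have h3 : ∀ σ : Fin n → ℝ, (MeasurableEquiv.piCongrLeft (fun _ : Fin n => ℝ) e.symm) σ
      = fun i => σ (e i) := by
    intro σ; ext i
    have := Equiv.piCongrLeft_apply (fun _ : Fin n => ℝ) e.symm σ i
    refine Eq.trans this ?_
    simp
  have h4 : (MeasurableEquiv.piCongrLeft (fun _ : Fin n => ℝ) e.symm) ⁻¹' (orth n) = orth n := by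
    ext σ
    simp only [Set.mem_preimage, h3, orth, Set.mem_ofPred_eq]
    constructor
    · intro h i; simpa using h (e.symm i)
    · intro h i; exact h _
  rw [h4]
  simp only [h3]

lemma integral_Ioi_off (f f' : ℝ → ℝ) (s : Set ℝ) (hs : s.Countable) (hc : Continuous f)
    (hd : ∀ x, 0 < x → x ∉ s → HasDerivAt f (f' x) x) (hi : IntegrableOn f' (Set.Ioi 0))
    (hl : Filter.Tendsto f Filter.atTop (nhds 0)) :
    ∫ x in Set.Ioi 0, f' x = - f 0 := by
  have h1 := intervalIntegral_tendsto_integral_Ioi 0 hi Filter.tendsto_id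
  have h2 : Filter.Tendsto (fun b : ℝ => f b - f 0) Filter.atTop (nhds (0 - f 0)) :=
    hl.sub_const _
  rw [zero_sub] at h2
  refine tendsto_nhds_unique h1 (h2.congr' ?_)
  filter_upwards [Filter.eventually_ge_atTop 0] with b hb
  symm
  refine integral_eq_of_hasDerivAt_off_countable_of_le f f' hb hs hc.continuousOn
    (fun x hx => hd x hx.1.1 hx.2) ?_
  rw [intervalIntegrable_iff, id, Set.uIoc_of_le hb]
  exact hi.mono_set Set.Ioc_subset_Ioi_self

lemma ibp {n : ℕ} (i : Fin (n+1)) (F F' : (Fin (n+1) → ℝ) → ℝ)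
    (hFint : IntegrableOn F' (orth (n+1)))
    (hc : ∀ y ∈ orth n, Continuous (fun x : ℝ => F (i.insertNth x y)))
    (hd : ∀ y ∈ orth n, ∃ s : Set ℝ, s.Countable ∧ ∀ x, 0 < x → x ∉ s →
      HasDerivAt (fun x : ℝ => F (i.insertNth x y)) (F' (i.insertNth x y)) x)
    (hl : ∀ y ∈ orth n,
      Filter.Tendsto (fun x : ℝ => F (i.insertNth x y)) Filter.atTop (nhds 0)) :
    ∫ σ in orth (n+1), F' σ = - ∫ y in orth n, F (i.insertNth 0 y) := by
  have h := (volume_preserving_piFinSuccAbove (fun _ : Fin (n+1) => ℝ) i).symm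
  have he := (MeasurableEquiv.piFinSuccAbove (fun _ : Fin (n+1) => ℝ) i).symm.measurableEmbedding
  have hpre : (MeasurableEquiv.piFinSuccAbove (fun _ : Fin (n+1) => ℝ) i).symm ⁻¹' (orth (n+1))
      = Set.Ioi (0:ℝ) ×ˢ orth n := by
    ext ⟨x, y⟩
    simp only [Set.mem_preimage, orth, Set.mem_ofPred_eq, Set.mem_prod, Set.mem_Ioi]
    rw [Fin.forall_iff_succAbove i]
    change (0 < (i.insertNth x y : Fin (n+1) → ℝ) i ∧
      ∀ j, 0 < (i.insertNth x y : Fin (n+1) → ℝ) (i.succAbove j)) ↔ _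
    simp
  have happ : ∀ z : ℝ × (Fin n → ℝ),
      (MeasurableEquiv.piFinSuccAbove (fun _ : Fin (n+1) => ℝ) i).symm z
      = (i.insertNth z.1 z.2 : Fin (n+1) → ℝ) := by
    intro z; rfl
  have h2 := h.setIntegral_preimage_emb he F' (orth (n+1))
  have h3 := (h.integrableOn_comp_preimage he (f := F') (s := orth (n+1))).2 hFint
  rw [hpre] at h2 h3
  rw [← h2]
  simp only [happ, Function.comp_def] at h3 ⊢
  have h3' : Integrable (fun z : ℝ × (Fin n → ℝ) => F' (i.insertNth z.1 z.2))
      ((volume.restrict (Set.Ioi (0:ℝ))).prod (volume.restrict (orth n))) := by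
    rw [Measure.prod_restrict]; exact h3
  rw [Measure.volume_eq_prod, ← Measure.prod_restrict, integral_prod_symm _ h3', ← integral_neg]
  refine integral_congr_ae ?_
  filter_upwards [h3'.prod_left_ae, ae_restrict_mem (measurableSet_orth n)] with y hy hy2
  obtain ⟨s, hs, hs2⟩ := hd y hy2
  exact integral_Ioi_off (fun x => F (i.insertNth x y)) (fun x => F' (i.insertNth x y)) s hs (hc y hy2) hs2 hy (hl y hy2)


noncomputable def g {n : ℕ} (p : ℕ) (y : Fin n → ℝ) (x : ℝ) : ℝ :=
  x ^ p * Real.exp (-(x ^ 2) / 2) * ∏ j, |x ^ 2 - y j ^ 2|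

lemma g_cont {n : ℕ} (p : ℕ) (y : Fin n → ℝ) : Continuous (g p y) := by
  unfold g; fun_prop

lemma g_lim {n : ℕ} (p : ℕ) (y : Fin n → ℝ) :
    Filter.Tendsto (g p y) Filter.atTop (nhds 0) := by
  let P : Polynomial ℝ := Polynomial.X ^ p * ∏ j, (Polynomial.X ^ 2 - Polynomial.C (y j ^ 2))
  have hP := (P.tendsto_div_exp_atTop).norm.mul_const (Real.exp (1/2))
  rw [norm_zero, zero_mul] at hP
  refine squeeze_zero_norm' ?_ hP
  filter_upwards with x
  have : P.eval x = x ^ p * ∏ j, (x ^ 2 - y j ^ 2) := by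
    simp [P, Polynomial.eval_prod]
  rw [this, g, norm_mul, norm_mul, norm_div, norm_mul, div_mul_eq_mul_div, div_eq_mul_inv]
  have h1 : ‖∏ j, |x ^ 2 - y j ^ 2|‖ = ‖∏ j, (x ^ 2 - y j ^ 2)‖ := by
    rw [norm_prod, norm_prod]; simp
  rw [h1]
  have h2 : ‖Real.exp (-(x^2)/2)‖ ≤ Real.exp (1/2) * ‖Real.exp x‖⁻¹ := by
    rw [Real.norm_of_nonneg (Real.exp_pos _).le, Real.norm_of_nonneg (Real.exp_pos _).le,
      ← Real.exp_neg, ← Real.exp_add, Real.exp_le_exp]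
    nlinarith [sq_nonneg (x - 1)]
  calc _ = ‖x ^ p‖ * ‖∏ j, (x ^ 2 - y j ^ 2)‖ * ‖Real.exp (-(x^2)/2)‖ := by ring
    _ ≤ ‖x ^ p‖ * ‖∏ j, (x ^ 2 - y j ^ 2)‖ * (Real.exp (1/2) * ‖Real.exp x‖⁻¹) := by gcongr
    _ = _ := by ring

lemma logd_mul {f h : ℝ → ℝ} {a b x : ℝ} (hf : HasDerivAt f (f x * a) x)
    (hh : HasDerivAt h (h x * b) x) :
    HasDerivAt (fun t => f t * h t) (f x * h x * (a + b)) x := by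
  refine (hf.mul hh).congr_deriv ?_
  ring_nf

lemma logd_prod {n : ℕ} (s : Finset (Fin n)) (f : Fin n → ℝ → ℝ) (a : Fin n → ℝ) (x : ℝ)
    (hf : ∀ j, HasDerivAt (f j) (f j x * a j) x) :
    HasDerivAt (fun t => ∏ j ∈ s, f j t) ((∏ j ∈ s, f j x) * ∑ j ∈ s, a j) x := by
  induction s using Finset.induction_on with
  | empty => simpa using hasDerivAt_const x (1:ℝ)
  | insert j s hj ih =>
    simp only [Finset.prod_insert hj, Finset.sum_insert hj]
    exact logd_mul (hf j) ih

lemma logd_abs (c x : ℝ) (h : x ^ 2 - c ≠ 0) :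
    HasDerivAt (fun t : ℝ => |t ^ 2 - c|) (|x ^ 2 - c| * (2 * x / (x ^ 2 - c))) x := by
  have h1 : HasDerivAt (fun t : ℝ => t ^ 2 - c) (2 * x) x := by
    simpa using (hasDerivAt_pow 2 x).sub_const c
  rcases lt_or_gt_of_ne h with h0 | h0
  · have := (hasDerivAt_abs_neg h0).comp x h1
    refine this.congr_deriv ?_
    rw [abs_of_neg h0]; field_simp
  · have := (hasDerivAt_abs_pos h0).comp x h1
    refine this.congr_deriv ?_
    rw [abs_of_pos h0]; field_simp

lemma g_deriv {n : ℕ} (p : ℕ) (y : Fin n → ℝ) (x : ℝ) (hx : x ≠ 0) (h : ∀ j, x ^ 2 - y j ^ 2 ≠ 0) :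
    HasDerivAt (g p y) (g p y x * (p / x - x + ∑ j, 2 * x / (x ^ 2 - y j ^ 2))) x := by
  unfold g
  refine logd_mul ?_ (logd_prod _ _ _ x fun j => logd_abs _ x (h j))
  rw [sub_eq_add_neg]
  refine logd_mul (f := fun t => t ^ p) ?_ ?_
  · refine (hasDerivAt_pow p x).congr_deriv ?_
    rcases p with _ | p
    · simp
    · simp only [Nat.add_sub_cancel, pow_succ]; field_simp
  · have : HasDerivAt (fun t : ℝ => -(t^2)/2) (-x) x := by
      refine (((hasDerivAt_pow 2 x).neg).div_const 2).congr_deriv ?_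
      simp
      ring
    exact this.exp

lemma ibp2 {n : ℕ} (i : Fin (n+1)) (p : ℕ) (H : (Fin n → ℝ) → ℝ) (G : (Fin (n+1) → ℝ) → ℝ)
    (hFint : IntegrableOn G (orth (n+1)))
    (hG : ∀ y ∈ orth n, ∀ x, 0 < x → G (i.insertNth x y) =
      g p y x * (p / x - x + ∑ j, 2 * x / (x ^ 2 - y j ^ 2)) * H y) :
    ∫ σ in orth (n+1), G σ = - ∫ y in orth n, g p y 0 * H y := by
  have := ibp i (fun σ => g p (fun j => σ (i.succAbove j)) (σ i) * H (fun j => σ (i.succAbove j))) G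
    hFint ?_ ?_ ?_
  · simpa using this
  · intro y hy
    simpa using (g_cont p y).mul_const _
  · intro y hy
    refine ⟨⋃ j, {y j}, Set.countable_iUnion fun j => Set.countable_singleton _, fun x hx hxs => ?_⟩
    simp only [Fin.insertNth_apply_same, Fin.insertNth_apply_succAbove]
    rw [hG y hy x hx]
    refine (g_deriv p y x hx.ne' fun j hj => hxs ?_).mul_const _
    rw [sub_eq_zero, sq_eq_sq₀ hx.le (hy j).le] at hj
    simp [hj]
  · intro y hy
    simpa using (g_lim p y).mul_const (H y)

noncomputable def W {n : ℕ} (σ : Fin n → ℝ) : ℝ := ∏ i, (1 + σ i ^ 2)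

lemma one_le_prod_aux {ι : Type*} (s : Finset ι) (f : ι → ℝ) (h : ∀ i ∈ s, 1 ≤ f i) :
    1 ≤ ∏ i ∈ s, f i := by
  calc (1:ℝ) = ∏ i ∈ s, (1:ℝ) := by simp
    _ ≤ _ := Finset.prod_le_prod (fun _ _ => zero_le_one) h

lemma one_le_W {n : ℕ} (σ : Fin n → ℝ) : 1 ≤ W σ :=
  one_le_prod_aux _ _ fun i _ => by nlinarith [sq_nonneg (σ i)]

lemma sq_le_W {n : ℕ} (σ : Fin n → ℝ) (i : Fin n) : σ i ^ 2 ≤ W σ := by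
  have : (1 + σ i ^ 2) ≤ W σ := by
    unfold W
    rw [← Finset.mul_prod_erase _ _ (Finset.mem_univ i)]
    refine le_mul_of_one_le_right (by positivity) ?_
    exact one_le_prod_aux _ _ fun i _ => by nlinarith [sq_nonneg (σ i)]
  linarith

lemma diff_le_W {n : ℕ} (σ : Fin n → ℝ) (i j : Fin n) : |σ i ^ 2 - σ j ^ 2| ≤ W σ := by
  have h1 := sq_le_W σ i
  have h2 := sq_le_W σ j
  rw [abs_le]; constructor <;> nlinarith [sq_nonneg (σ i), sq_nonneg (σ j)]

lemma prodsq_le_W {n : ℕ} (σ : Fin n → ℝ) (S : Finset (Fin n)) :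
    |∏ i ∈ S, σ i ^ 2| ≤ W σ := by
  rw [abs_of_nonneg (Finset.prod_nonneg fun _ _ => sq_nonneg _)]
  calc ∏ i ∈ S, σ i ^ 2 ≤ ∏ i ∈ S, (1 + σ i ^ 2) :=
        Finset.prod_le_prod (fun _ _ => sq_nonneg _) fun i _ => by linarith
    _ ≤ W σ := by
        unfold W
        rw [← Finset.prod_sdiff (Finset.subset_univ S)]
        refine le_mul_of_one_le_left (Finset.prod_nonneg fun _ _ => by positivity) ?_
        exact one_le_prod_aux _ _ fun i _ => by nlinarith [sq_nonneg (σ i)]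

lemma prod_le_W {n : ℕ} (σ : Fin n → ℝ) : |∏ i, σ i| ≤ W σ := by
  rw [Finset.abs_prod]
  refine Finset.prod_le_prod (fun _ _ => abs_nonneg _) fun i _ => ?_
  rw [abs_le]; constructor <;> nlinarith [sq_nonneg (σ i - 1), sq_nonneg (σ i + 1)]

lemma int1 (N : ℕ) : Integrable (fun x : ℝ => (1 + x ^ 2) ^ N * Real.exp (-(x ^ 2) / 2)) := by
  have h := (integrable_exp_neg_mul_sq (b := 1/4) (by norm_num)).const_mul
    (4 ^ N * (N.factorial : ℝ) * Real.exp (1/4))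
  refine h.mono' (by fun_prop) ?_
  filter_upwards with x
  rw [Real.norm_of_nonneg (by positivity)]
  have h1 := Real.pow_div_factorial_le_exp ((1 + x ^ 2) / 4) (by positivity) N
  rw [div_le_iff₀ (by positivity), div_pow, div_le_iff₀ (by positivity)] at h1
  calc (1 + x ^ 2) ^ N * Real.exp (-(x ^ 2) / 2)
      ≤ (Real.exp ((1 + x ^ 2) / 4) * N.factorial * 4 ^ N) * Real.exp (-(x ^ 2) / 2) := by gcongr
    _ = 4 ^ N * (N.factorial : ℝ) * (Real.exp ((1 + x ^ 2) / 4) * Real.exp (-(x ^ 2) / 2)) := by ring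
    _ = 4 ^ N * (N.factorial : ℝ) * (Real.exp (1/4) * Real.exp (-(1/4) * x ^ 2)) := by
        rw [← Real.exp_add, ← Real.exp_add]; ring_nf
    _ = _ := by ring

noncomputable def E {n : ℕ} (σ : Fin n → ℝ) : ℝ := Real.exp (-(∑ i, σ i ^ 2) / 2)

lemma int_bound {n : ℕ} (N : ℕ) (f : (Fin n → ℝ) → ℝ) (hm : Measurable f)
    (hf : ∀ σ, |f σ| ≤ W σ ^ N * E σ) : Integrable f := by
  have h : Integrable (fun σ : Fin n → ℝ => ∏ i, ((1 + σ i ^ 2) ^ N * Real.exp (-(σ i ^ 2) / 2))) :=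
    Integrable.fintype_prod (f := fun _ x => (1 + x ^ 2) ^ N * Real.exp (-(x ^ 2) / 2))
      fun _ => int1 N
  refine h.mono' hm.aestronglyMeasurable ?_
  filter_upwards with σ
  refine (hf σ).trans (le_of_eq ?_)
  rw [Finset.prod_mul_distrib, Finset.prod_pow, ← Real.exp_sum, ← Finset.sum_div,
    Finset.sum_neg_distrib]
  rfl

lemma E_meas {n : ℕ} : Measurable (E (n := n)) := by unfold E; fun_prop
lemma D_meas {n : ℕ} : Measurable (D (n := n)) := by unfold D; fun_prop

lemma E_pos {n : ℕ} (σ : Fin n → ℝ) : 0 < E σ := Real.exp_pos _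

noncomputable def npairs (n : ℕ) : ℕ := (Finset.univ.filter (fun p : Fin n × Fin n => p.1 < p.2)).card

lemma D_le {n : ℕ} (σ : Fin n → ℝ) : D σ ≤ W σ ^ npairs n := by
  unfold D npairs
  rw [← Finset.prod_const]
  exact Finset.prod_le_prod (fun _ _ => abs_nonneg _) fun p _ => diff_le_W σ _ _

lemma D_factor {n : ℕ} (σ : Fin n → ℝ) {i j : Fin n} (hij : i ≠ j) :
    ∃ R : ℝ, 0 ≤ R ∧ R ≤ W σ ^ npairs n ∧ D σ = |σ i ^ 2 - σ j ^ 2| * R := by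
  have hex : ∃ p ∈ Finset.univ.filter (fun p : Fin n × Fin n => p.1 < p.2),
      |σ p.1 ^ 2 - σ p.2 ^ 2| = |σ i ^ 2 - σ j ^ 2| := by
    rcases lt_or_gt_of_ne hij with h | h
    · exact ⟨(i, j), by simp [h], rfl⟩
    · exact ⟨(j, i), by simp [h], abs_sub_comm _ _⟩
  obtain ⟨p, hp, hp2⟩ := hex
  refine ⟨∏ q ∈ (Finset.univ.filter (fun p : Fin n × Fin n => p.1 < p.2)).erase p,
    |σ q.1 ^ 2 - σ q.2 ^ 2|, Finset.prod_nonneg fun _ _ => abs_nonneg _, ?_, ?_⟩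
  · calc _ ≤ ∏ q ∈ (Finset.univ.filter (fun p : Fin n × Fin n => p.1 < p.2)).erase p, W σ :=
          Finset.prod_le_prod (fun _ _ => abs_nonneg _) fun p _ => diff_le_W σ _ _
      _ ≤ _ := by
        rw [Finset.prod_const]
        exact pow_le_pow_right₀ (one_le_W σ) (Finset.card_le_card (Finset.erase_subset _ _))
  · rw [← hp2, Finset.mul_prod_erase _ (fun q : Fin n × Fin n => |σ q.1 ^ 2 - σ q.2 ^ 2|) hp]; rfl

lemma int_gen {n : ℕ} (k : ℕ) (h : (Fin n → ℝ) → ℝ) (hm : Measurable h)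
    (hh : ∀ σ, |h σ| ≤ W σ ^ k) : Integrable (fun σ => h σ * (E σ * D σ)) := by
  refine int_bound (k + npairs n) _ (hm.mul (E_meas.mul D_meas)) fun σ => ?_
  have h1 := D_le σ
  have h0 := D_nonneg σ
  have h2 := E_pos σ
  have h3 := one_le_W σ
  rw [abs_mul, abs_of_nonneg (by positivity : 0 ≤ E σ * D σ), pow_add]
  calc |h σ| * (E σ * D σ) ≤ W σ ^ k * (E σ * W σ ^ npairs n) := by
        gcongr; exact hh σ
    _ = _ := by ring

lemma int_gen2 {n : ℕ} (k : ℕ) (h : (Fin n → ℝ) → ℝ) (hm : Measurable h)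
    (hh : ∀ σ, |h σ| ≤ W σ ^ k) {i j : Fin n} (hij : i ≠ j) :
    Integrable (fun σ => h σ / (σ i ^ 2 - σ j ^ 2) * (E σ * D σ)) := by
  refine int_bound (k + npairs n) _ ((hm.div (by fun_prop)).mul (E_meas.mul D_meas)) fun σ => ?_
  obtain ⟨R, hR0, hR, hD⟩ := D_factor σ hij
  have h2 := E_pos σ
  have h3 := one_le_W σ
  have h4 : |h σ / (σ i ^ 2 - σ j ^ 2) * (E σ * D σ)| ≤ |h σ| * (E σ * R) := by
    rw [hD, abs_mul, abs_div, abs_of_nonneg (by positivity : 0 ≤ E σ * (|σ i ^ 2 - σ j ^ 2| * R))]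
    rcases (abs_nonneg (σ i ^ 2 - σ j ^ 2)).eq_or_lt with h | h
    · rw [← h]; simp; positivity
    · apply le_of_eq; field_simp
  refine h4.trans ?_
  rw [pow_add]
  calc |h σ| * (E σ * R) ≤ W σ ^ k * (E σ * W σ ^ npairs n) := by
        gcongr; exact hh σ
    _ = _ := by ring


noncomputable def B {n : ℕ} (m : ℕ) (S : Finset (Fin n)) (σ : Fin n → ℝ) : ℝ :=
  (∏ i ∈ S, σ i ^ 2) * (∏ i, σ i) ^ m * (E σ * D σ)

noncomputable def A (n m : ℕ) (S : Finset (Fin n)) : ℝ := ∫ σ in orth n, B m S σ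

lemma B_coef_le {n : ℕ} (m : ℕ) (S : Finset (Fin n)) (σ : Fin n → ℝ) :
    |(∏ i ∈ S, σ i ^ 2) * (∏ i, σ i) ^ m| ≤ W σ ^ (m + 1) := by
  rw [abs_mul, abs_pow, pow_succ']
  have := one_le_W σ
  gcongr
  · exact prodsq_le_W σ S
  · exact prod_le_W σ

lemma B_int {n : ℕ} (m : ℕ) (S : Finset (Fin n)) : Integrable (B m S) :=
  int_gen (m + 1) _ (by fun_prop) (B_coef_le m S)

lemma B_insert {n : ℕ} (m : ℕ) (S : Finset (Fin n)) (i : Fin n) (hi : i ∉ S) (σ : Fin n → ℝ) :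
    B m (insert i S) σ = σ i ^ 2 * B m S σ := by
  unfold B; rw [Finset.prod_insert hi]; ring

lemma T_int {n : ℕ} (m : ℕ) (S : Finset (Fin n)) {i j : Fin n} (hij : i ≠ j) :
    Integrable (fun σ => 2 * σ i ^ 2 / (σ i ^ 2 - σ j ^ 2) * B m S σ) := by
  have := (int_gen2 (m + 2) (fun σ => σ i ^ 2 * ((∏ i ∈ S, σ i ^ 2) * (∏ i, σ i) ^ m))
    (by fun_prop) (fun σ => ?_) hij).const_mul 2
  · refine this.congr (Filter.Eventually.of_forall fun σ => ?_)
    simp only [B]; ring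
  · rw [abs_mul, pow_succ' (W σ) (m + 1)]
    have h1 := one_le_W σ
    have h2 := B_coef_le m S σ
    have h3 := sq_le_W σ i
    rw [abs_of_nonneg (sq_nonneg (σ i))]
    gcongr

lemma U_int {n : ℕ} (m : ℕ) (S : Finset (Fin n)) {i j : Fin n} (hij : i ≠ j) :
    Integrable (fun σ => 2 / (σ i ^ 2 - σ j ^ 2) * B m S σ) := by
  have := (int_gen2 (m + 1) (fun σ => ((∏ i ∈ S, σ i ^ 2) * (∏ i, σ i) ^ m))
    (by fun_prop) (fun σ => B_coef_le m S σ) hij).const_mul 2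
  refine this.congr (Filter.Eventually.of_forall fun σ => ?_)
  simp only [B]; ring

lemma E_perm {n : ℕ} (σ : Fin n → ℝ) (e : Equiv.Perm (Fin n)) : E (fun i => σ (e i)) = E σ := by
  unfold E; rw [Equiv.sum_comp e (fun i => σ i ^ 2)]

lemma B_perm {n : ℕ} (m : ℕ) (S : Finset (Fin n)) (σ : Fin n → ℝ) (e : Equiv.Perm (Fin n)) :
    B m S (fun i => σ (e i)) = (∏ i ∈ S, σ (e i) ^ 2) * (∏ i, σ i) ^ m * (E σ * D σ) := by
  unfold B; rw [E_perm, D_perm, Equiv.prod_comp e σ]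

lemma swap_prod_fix {n : ℕ} (S : Finset (Fin n)) {i j : Fin n} (hi : i ∉ S) (hj : j ∉ S)
    (σ : Fin n → ℝ) : ∏ k ∈ S, σ (Equiv.swap i j k) ^ 2 = ∏ k ∈ S, σ k ^ 2 := by
  refine Finset.prod_congr rfl fun k hk => ?_
  rw [Equiv.swap_apply_of_ne_of_ne] <;> rintro rfl <;> contradiction

lemma U_zero {n : ℕ} (m : ℕ) {i j : Fin n} :
    ∫ σ in orth n, 2 / (σ i ^ 2 - σ j ^ 2) * B m ∅ σ = 0 := by
  have h := integral_perm (Equiv.swap i j) (fun σ => 2 / (σ i ^ 2 - σ j ^ 2) * B m ∅ σ)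
  have h2 : ∀ σ : Fin n → ℝ, 2 / (σ (Equiv.swap i j i) ^ 2 - σ (Equiv.swap i j j) ^ 2) *
      B m ∅ (fun k => σ (Equiv.swap i j k)) = - (2 / (σ i ^ 2 - σ j ^ 2) * B m ∅ σ) := by
    intro σ
    rw [B_perm, Equiv.swap_apply_left, Equiv.swap_apply_right, ← neg_sub (σ i ^ 2), div_neg]
    simp [B]
  simp only [h2, integral_neg] at h
  linarith

lemma T_zero {n : ℕ} (m : ℕ) (S : Finset (Fin n)) {i j : Fin n} (hi : i ∉ S) (hj : j ∈ S) :
    ∫ σ in orth n, 2 * σ i ^ 2 / (σ i ^ 2 - σ j ^ 2) * B m S σ = 0 := by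
  have h := integral_perm (Equiv.swap i j)
    (fun σ => 2 * σ i ^ 2 / (σ i ^ 2 - σ j ^ 2) * B m S σ)
  have h2 : ∀ σ : Fin n → ℝ, 2 * σ (Equiv.swap i j i) ^ 2 /
      (σ (Equiv.swap i j i) ^ 2 - σ (Equiv.swap i j j) ^ 2) *
      B m S (fun k => σ (Equiv.swap i j k)) = - (2 * σ i ^ 2 / (σ i ^ 2 - σ j ^ 2) * B m S σ) := by
    intro σ
    rw [B_perm, Equiv.swap_apply_left, Equiv.swap_apply_right, ← neg_sub (σ i ^ 2), div_neg]
    unfold B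
    have hie : i ∉ S.erase j := fun h => hi (Finset.mem_of_mem_erase h)
    have hje : j ∉ S.erase j := Finset.notMem_erase j S
    rw [← Finset.mul_prod_erase S _ hj, ← Finset.mul_prod_erase S _ hj, Equiv.swap_apply_right,
      swap_prod_fix _ hie hje]
    ring
  simp only [h2, integral_neg] at h
  linarith

lemma T_one {n : ℕ} (m : ℕ) (S : Finset (Fin n)) {i j : Fin n} (hij : i ≠ j)
    (hi : i ∉ S) (hj : j ∉ S) :
    ∫ σ in orth n, 2 * σ i ^ 2 / (σ i ^ 2 - σ j ^ 2) * B m S σ = A n m S := by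
  have h := integral_perm (Equiv.swap i j)
    (fun σ => 2 * σ i ^ 2 / (σ i ^ 2 - σ j ^ 2) * B m S σ)
  have h2 : ∀ σ : Fin n → ℝ, 2 * σ (Equiv.swap i j i) ^ 2 /
      (σ (Equiv.swap i j i) ^ 2 - σ (Equiv.swap i j j) ^ 2) *
      B m S (fun k => σ (Equiv.swap i j k)) =
      2 * B m S σ - (2 * σ i ^ 2 / (σ i ^ 2 - σ j ^ 2) * B m S σ) := by
    intro σ
    rw [B_perm, swap_prod_fix _ hi hj, Equiv.swap_apply_left, Equiv.swap_apply_right]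
    change _ * B m S σ = _
    rcases eq_or_ne (σ i ^ 2 - σ j ^ 2) 0 with h0 | h0
    · have : B m S σ = 0 := by
        obtain ⟨R, -, -, hR⟩ := D_factor σ hij
        unfold B; rw [hR, h0]; simp
      rw [this]; simp
    · have h1 : σ j ^ 2 - σ i ^ 2 ≠ 0 := by rw [← neg_sub]; exact neg_ne_zero.2 h0
      rw [← neg_sub (σ i ^ 2) (σ j ^ 2)]
      field_simp
      ring
  simp only [h2] at h
  rw [integral_sub ((B_int m S).integrableOn.const_mul 2) (T_int m S hij).integrableOn,
    integral_const_mul] at h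
  unfold A
  linarith

noncomputable def H {n : ℕ} (m : ℕ) (S : Finset (Fin (n+1))) (i : Fin (n+1)) (y : Fin n → ℝ) : ℝ :=
  (∏ k ∈ S, (i.insertNth 0 y : Fin (n+1) → ℝ) k ^ 2) * (∏ j, y j) ^ m * (E y * D y)

lemma E_insertNth {n : ℕ} (i : Fin (n+1)) (x : ℝ) (y : Fin n → ℝ) :
    E (i.insertNth x y : Fin (n+1) → ℝ) = Real.exp (-(x ^ 2) / 2) * E y := by
  unfold E
  rw [Fin.sum_univ_succAbove _ i, ← Real.exp_add]
  simp only [Fin.insertNth_apply_same, Fin.insertNth_apply_succAbove]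
  congr 1; ring

lemma B_insertNth {n : ℕ} (m : ℕ) (S : Finset (Fin (n+1))) (i : Fin (n+1)) (hi : i ∉ S)
    (x : ℝ) (y : Fin n → ℝ) :
    B m S (i.insertNth x y : Fin (n+1) → ℝ) = g m y x * H m S i y := by
  unfold B H g
  have h1 : ∏ k ∈ S, (i.insertNth x y : Fin (n+1) → ℝ) k ^ 2
      = ∏ k ∈ S, (i.insertNth 0 y : Fin (n+1) → ℝ) k ^ 2 := by
    refine Finset.prod_congr rfl fun k hk => ?_
    have hki : k ≠ i := by rintro rfl; contradiction
    obtain ⟨j, rfl⟩ := Fin.exists_succAbove_eq hki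
    simp
  rw [h1, E_insertNth, D_insertNth, Fin.prod_univ_succAbove _ i]
  simp only [Fin.insertNth_apply_same, Fin.insertNth_apply_succAbove, mul_pow]
  ring

lemma A_step {n : ℕ} (m : ℕ) (S : Finset (Fin (n+1))) (i : Fin (n+1)) (hi : i ∉ S) :
    A (n+1) m (insert i S) = (m + 1 + n - S.card) * A (n+1) m S := by
  have hne : ∀ j : Fin n, i ≠ i.succAbove j := fun j => (Fin.succAbove_ne i j).symm
  have hI : ∀ j : Fin n, IntegrableOn (fun σ : Fin (n+1) → ℝ =>
    2 * σ i ^ 2 / (σ i ^ 2 - σ (i.succAbove j) ^ 2) * B m S σ) (orth (n+1)) :=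
    fun j => (T_int m S (hne j)).integrableOn
  have hsum : IntegrableOn (fun σ : Fin (n+1) → ℝ => ∑ j : Fin n,
    2 * σ i ^ 2 / (σ i ^ 2 - σ (i.succAbove j) ^ 2) * B m S σ) (orth (n+1)) :=
    integrable_finsetSum _ fun j _ => hI j
  have hB : IntegrableOn (fun σ : Fin (n+1) → ℝ => ((m:ℝ)+1) * B m S σ) (orth (n+1)) :=
    (B_int m S).integrableOn.const_mul _
  have hB2 : IntegrableOn (fun σ : Fin (n+1) → ℝ => B m (insert i S) σ) (orth (n+1)) :=
    (B_int m _).integrableOn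
  have hS : IntegrableOn (fun σ : Fin (n+1) → ℝ => ((m:ℝ)+1) * B m S σ - B m (insert i S) σ)
    (orth (n+1)) := hB.sub hB2
  have key := ibp2 i (m+1) (H m S i) (fun σ => ((m:ℝ)+1) * B m S σ - B m (insert i S) σ +
    ∑ j : Fin n, 2 * σ i ^ 2 / (σ i ^ 2 - σ (i.succAbove j) ^ 2) * B m S σ)
    (hS.add hsum) ?_
  · have h0 : ∀ y : Fin n → ℝ, g (m+1) y 0 = 0 := by intro y; simp [g]
    rw [integral_add hS hsum, integral_sub hB hB2, integral_const_mul,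
      integral_finsetSum _ fun j _ => hI j] at key
    simp only [h0, zero_mul, integral_zero, neg_zero] at key
    have hs : ∑ j : Fin n, ∫ σ in orth (n+1), 2 * σ i ^ 2 / (σ i ^ 2 - σ (i.succAbove j) ^ 2) *
        B m S σ = (n - S.card) * A (n+1) m S := by
      have h1 : ∀ j : Fin n, (∫ σ in orth (n+1), 2 * σ i ^ 2 / (σ i ^ 2 - σ (i.succAbove j) ^ 2) *
        B m S σ) = (1 - if i.succAbove j ∈ S then 1 else 0) * A (n+1) m S := by
        intro j
        split_ifs with hj
        · rw [T_zero m S hi hj]; simp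
        · rw [T_one m S (hne j) hi hj]; simp
      simp only [h1]
      rw [← Finset.sum_mul, Finset.sum_sub_distrib]
      congr 1
      have h2 : ∑ k : Fin (n+1), (if k ∈ S then (1:ℝ) else 0) = S.card := by simp
      rw [Fin.sum_univ_succAbove _ i, if_neg hi, zero_add] at h2
      rw [h2]; simp
    rw [hs] at key
    change (m + 1) * A (n+1) m S - A (n+1) m (insert i S) + _ = 0 at key
    linarith
  · intro y hy x hx
    simp only [B_insert m S i hi, B_insertNth m S i hi, Fin.insertNth_apply_same,
      Fin.insertNth_apply_succAbove]
    have h1 : g (m+1) y x = x * g m y x := by unfold g; ring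
    have h2 : ∑ j, 2 * x / (x ^ 2 - y j ^ 2) * x = ∑ j, 2 * x ^ 2 / (x ^ 2 - y j ^ 2) :=
      Finset.sum_congr rfl fun j _ => by ring
    rw [h1, ← Finset.sum_mul, ← h2, ← Finset.sum_mul]
    push_cast
    field_simp

lemma A_bdry (n : ℕ) : A (n+1) 1 ∅ = A n 3 ∅ := by
  have hne : ∀ j : Fin n, (0 : Fin (n+1)) ≠ (0 : Fin (n+1)).succAbove j :=
    fun j => (Fin.succAbove_ne _ j).symm
  have hI : ∀ j : Fin n, IntegrableOn (fun σ : Fin (n+1) → ℝ =>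
    2 / (σ 0 ^ 2 - σ ((0 : Fin (n+1)).succAbove j) ^ 2) * B 1 ∅ σ) (orth (n+1)) :=
    fun j => (U_int 1 ∅ (hne j)).integrableOn
  have hsum : IntegrableOn (fun σ : Fin (n+1) → ℝ => ∑ j : Fin n,
    2 / (σ 0 ^ 2 - σ ((0 : Fin (n+1)).succAbove j) ^ 2) * B 1 ∅ σ) (orth (n+1)) :=
    integrable_finsetSum _ fun j _ => hI j
  have hB : IntegrableOn (fun σ : Fin (n+1) → ℝ => B 1 ∅ σ) (orth (n+1)) :=
    (B_int 1 _).integrableOn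
  have hN : IntegrableOn (fun σ : Fin (n+1) → ℝ => - B 1 ∅ σ) (orth (n+1)) := hB.neg
  have key := ibp2 (0 : Fin (n+1)) 0 (H 1 ∅ 0) (fun σ => - B 1 ∅ σ +
    ∑ j : Fin n, 2 / (σ 0 ^ 2 - σ ((0 : Fin (n+1)).succAbove j) ^ 2) * B 1 ∅ σ)
    (hN.add hsum) ?_
  · rw [integral_add hN hsum, integral_neg,
      integral_finsetSum _ fun j _ => hI j] at key
    simp only [U_zero, Finset.sum_const_zero, add_zero, neg_inj] at key
    change A (n+1) 1 ∅ = _ at key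
    rw [key]
    unfold A
    congr 1
    ext y
    have h1 : ∀ j : Fin n, |(0:ℝ) ^ 2 - y j ^ 2| = y j ^ 2 := fun j => by
      rw [abs_sub_comm]; simp
    simp only [g, H, B, h1, Finset.prod_empty, Finset.prod_pow]
    simp
    ring
  · intro y hy x hx
    have hx' := hx.ne'
    rw [B_insertNth 1 ∅ 0 (by simp)]
    simp only [Fin.insertNth_apply_same, Fin.insertNth_apply_succAbove]
    have h1 : g 1 y x = x * g 0 y x := by unfold g; ring
    have h2 : ∑ j, 2 * x / (x ^ 2 - y j ^ 2) = x * ∑ j, 2 / (x ^ 2 - y j ^ 2) := by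
      rw [Finset.mul_sum]; exact Finset.sum_congr rfl fun j _ => by ring
    rw [h1, ← Finset.sum_mul, h2]
    simp
    ring


noncomputable def P (n m : ℕ) : ℝ := ∏ j ∈ Finset.range n, ((m : ℝ) + 1 + j)

lemma P_pos (n m : ℕ) : 0 < P n m := Finset.prod_pos fun j _ => by positivity

lemma P_tel (n m : ℕ) : P n (m+1) * (m + 1) = P n m * (m + 1 + n) := by
  induction n with
  | zero => simp [P]
  | succ n ih =>
    unfold P at *
    rw [Finset.prod_range_succ, Finset.prod_range_succ]
    push_cast at *
    linear_combination ((m:ℝ) + 1 + 1 + n) * ih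

lemma A_card {n : ℕ} (m : ℕ) (S : Finset (Fin (n+1))) :
    A (n+1) m S = (∏ j ∈ Finset.range S.card, ((m:ℝ) + 1 + n - j)) * A (n+1) m ∅ := by
  induction S using Finset.induction_on with
  | empty => simp
  | insert i S hi ih =>
    rw [A_step m S i hi, Finset.card_insert_of_notMem hi, Finset.prod_range_succ, ih]; ring

lemma A_rec (n m : ℕ) : A n (m+2) ∅ = P n m * A n m ∅ := by
  have h1 : A n (m+2) ∅ = A n m Finset.univ := by
    unfold A; congr 1; ext σ
    simp only [B, Finset.prod_empty, Finset.prod_pow]; ring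
  rw [h1]
  rcases n with _ | n
  · simp [P, Finset.univ_eq_empty]
  · rw [A_card]
    congr 1
    unfold P
    rw [Finset.card_univ, Fintype.card_fin, ← Finset.prod_range_reflect]
    refine Finset.prod_congr rfl fun j hj => ?_
    have : j ≤ n := by simp at hj; omega
    rw [show n + 1 - 1 - j = n - j by omega, Nat.cast_sub this]; ring

lemma A_nonneg (n m : ℕ) : 0 ≤ A n m ∅ := by
  refine setIntegral_nonneg (measurableSet_orth n) fun σ hσ => ?_
  have h1 := D_nonneg σ
  have h2 := E_pos σ
  have h3 : 0 ≤ ∏ i, σ i := Finset.prod_nonneg fun i _ => (hσ i).le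
  unfold B
  simp only [Finset.prod_empty]
  positivity

lemma A_cs (n m : ℕ) : A n (m+1) ∅ ^ 2 ≤ A n m ∅ * A n (m+2) ∅ := by
  have h : ∀ t : ℝ, 0 ≤ A n m ∅ * (t * t) + (-2 * A n (m+1) ∅) * t + A n (m+2) ∅ := by
    intro t
    have i0 : IntegrableOn (fun σ => (t * t) * B m ∅ σ) (orth n) :=
      (B_int m ∅).integrableOn.const_mul _
    have i1 : IntegrableOn (fun σ => (2 * t) * B (m+1) ∅ σ) (orth n) :=
      (B_int (m+1) ∅).integrableOn.const_mul _
    have i2 : IntegrableOn (fun σ => B (m+2) ∅ σ) (orth n) := (B_int (m+2) ∅).integrableOn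
    have i01 : IntegrableOn (fun σ => (t * t) * B m ∅ σ - (2 * t) * B (m+1) ∅ σ) (orth n) :=
      i0.sub i1
    have e : ∫ σ in orth n, ((t * t) * B m ∅ σ - (2 * t) * B (m+1) ∅ σ + B (m+2) ∅ σ)
        = A n m ∅ * (t * t) + (-2 * A n (m+1) ∅) * t + A n (m+2) ∅ := by
      rw [integral_add i01 i2, integral_sub i0 i1, integral_const_mul, integral_const_mul]
      unfold A; ring
    rw [← e]
    refine setIntegral_nonneg (measurableSet_orth n) fun σ hσ => ?_
    have h1 := D_nonneg σ
    have h2 := E_pos σ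
    have h3 : 0 ≤ ∏ i, σ i := Finset.prod_nonneg fun i _ => (hσ i).le
    have : (t * t) * B m ∅ σ - (2 * t) * B (m+1) ∅ σ + B (m+2) ∅ σ
        = (t - ∏ i, σ i) ^ 2 * ((∏ i, σ i) ^ m * (E σ * D σ)) := by
      simp only [B, Finset.prod_empty]; ring
    rw [this]
    positivity
  have := discrim_le_zero h
  unfold discrim at this
  nlinarith

lemma uniq_le (n : ℕ) (u v : ℕ → ℝ) (hu : ∀ m, u (m+2) = P n m * u m)
    (hv : ∀ m, v (m+2) = P n m * v m) (cu : ∀ m, u (m+1) ^ 2 ≤ u m * u (m+2))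
    (cv : ∀ m, v (m+1) ^ 2 ≤ v m * v (m+2)) (h1 : u 1 = v 1) : v 0 ^ 2 ≤ u 0 ^ 2 := by
  have hodd : ∀ k, u (2*k+1) = v (2*k+1) := by
    intro k
    induction k with
    | zero => simpa using h1
    | succ k ih => rw [show 2*(k+1)+1 = (2*k+1)+2 by ring, hu, hv, ih]
  have heven : ∀ k, ∃ c > 0, u (2*k) = c * u 0 ∧ v (2*k) = c * v 0 := by
    intro k
    induction k with
    | zero => exact ⟨1, one_pos, by simp, by simp⟩
    | succ k ih =>
      obtain ⟨c, hc, h1, h2⟩ := ih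
      refine ⟨P n (2*k) * c, mul_pos (P_pos _ _) hc, ?_, ?_⟩
      · rw [show 2*(k+1) = 2*k+2 by ring, hu, h1]; ring
      · rw [show 2*(k+1) = 2*k+2 by ring, hv, h2]; ring
  have key : ∀ k : ℕ, v 0 ^ 2 * (2*k+1) ≤ u 0 ^ 2 * (2*k+1+n) := by
    intro k
    obtain ⟨c, hc, e1, e2⟩ := heven k
    have a1 := cv (2*k+1)
    have a2 := cu (2*k)
    rw [show 2*k+1+1 = 2*k+2 by ring, hv, hv, ← hodd k, e2] at a1
    rw [hu, e1] at a2
    have p0 := P_pos n (2*k)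
    have p1 := P_pos n (2*k+1)
    have t := P_tel n (2*k)
    push_cast at t
    have b : (P n (2*k) * c^2) * (P n (2*k) * v 0 ^ 2) ≤
        (P n (2*k) * c^2) * (P n (2*k+1) * u 0 ^ 2) := by
      calc _ = (P n (2*k) * (c * v 0)) ^ 2 := by ring
        _ ≤ P n (2*k+1) * u (2*k+1) ^ 2 := by linarith
        _ ≤ P n (2*k+1) * (c * u 0 * (P n (2*k) * (c * u 0))) := by gcongr
        _ = _ := by ring
    have b2 := le_of_mul_le_mul_left b (by positivity)
    have b3 : P n (2*k) * (v 0 ^ 2 * (2*k+1)) ≤ P n (2*k) * (u 0 ^ 2 * (2*k+1+n)) := by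
      calc _ = (P n (2*k) * v 0 ^ 2) * (2*k+1) := by ring
        _ ≤ (P n (2*k+1) * u 0 ^ 2) * (2*k+1) := by gcongr
        _ = (P n (2*k+1) * (2*k+1)) * u 0 ^ 2 := by ring
        _ = _ := by rw [t]; ring
    exact le_of_mul_le_mul_left b3 p0
  by_contra hlt
  push Not at hlt
  have hd : 0 < v 0 ^ 2 - u 0 ^ 2 := by linarith
  obtain ⟨k, hk⟩ := exists_nat_gt (u 0 ^ 2 * n / (v 0 ^ 2 - u 0 ^ 2))
  rw [div_lt_iff₀ hd] at hk
  have := key k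
  have hk0 : (0:ℝ) ≤ k := Nat.cast_nonneg k
  nlinarith

lemma uniq (n : ℕ) (u v : ℕ → ℝ) (hu : ∀ m, u (m+2) = P n m * u m)
    (hv : ∀ m, v (m+2) = P n m * v m) (cu : ∀ m, u (m+1) ^ 2 ≤ u m * u (m+2))
    (cv : ∀ m, v (m+1) ^ 2 ≤ v m * v (m+2)) (h1 : u 1 = v 1) (hu0 : 0 ≤ u 0) (hv0 : 0 ≤ v 0) :
    u 0 = v 0 := by
  have h2 := uniq_le n u v hu hv cu cv h1
  have h3 := uniq_le n v u hv hu cv cu h1.symm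
  exact (sq_eq_sq₀ hu0 hv0).1 (le_antisymm h3 h2)

noncomputable def K (n : ℕ) : ℝ := (2 : ℝ) ^ (((n ^ 2 : ℕ) : ℝ) / 2) / π ^ ((n : ℝ) / 2) *
  ∏ j ∈ Finset.Icc 1 n, Real.Gamma ((j : ℝ) / 2) * Real.Gamma ((j : ℝ) / 2 + 1)

lemma K_pos (n : ℕ) : 0 < K n := by
  unfold K
  refine mul_pos (by positivity) (Finset.prod_pos fun j hj => ?_)
  have : (0:ℝ) < j := by simp at hj; exact_mod_cast hj.1
  exact mul_pos (Real.Gamma_pos_of_pos (by positivity)) (Real.Gamma_pos_of_pos (by positivity))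

lemma K_succ (n : ℕ) : K (n+1) = K n * ((2:ℝ) ^ ((n:ℝ) + 1/2) / √π *
    (Real.Gamma (((n:ℝ)+1)/2) * Real.Gamma (((n:ℝ)+1)/2 + 1))) := by
  unfold K
  rw [Finset.prod_Icc_succ_top (by omega)]
  have h1 : (2:ℝ) ^ ((((n+1) ^ 2 : ℕ) : ℝ) / 2) =
      (2 : ℝ) ^ (((n ^ 2 : ℕ) : ℝ) / 2) * (2:ℝ) ^ ((n:ℝ) + 1/2) := by
    rw [← Real.rpow_add two_pos]; congr 1; push_cast; ring
  have h2 : π ^ (((n+1 : ℕ) : ℝ) / 2) = π ^ ((n : ℝ) / 2) * √π := by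
    rw [Real.sqrt_eq_rpow, ← Real.rpow_add Real.pi_pos]; congr 1; push_cast; ring
  rw [h1, h2]
  push_cast
  field_simp

noncomputable def fac (j m : ℕ) : ℝ :=
  √2 ^ m * Real.Gamma (((m:ℝ) + j + 1) / 2) / Real.Gamma (((j:ℝ) + 1) / 2)

lemma fac_pos (j m : ℕ) : 0 < fac j m := by
  unfold fac
  have h1 := Real.Gamma_pos_of_pos (s := ((m:ℝ) + j + 1) / 2) (by positivity)
  have h2 := Real.Gamma_pos_of_pos (s := ((j:ℝ) + 1) / 2) (by positivity)
  positivity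

lemma fac_rec (j m : ℕ) : fac j (m+2) = ((m:ℝ) + 1 + j) * fac j m := by
  unfold fac
  have h : (((m+2 : ℕ):ℝ) + j + 1) / 2 = ((m:ℝ) + j + 1) / 2 + 1 := by push_cast; ring
  rw [h, Real.Gamma_add_one (by positivity), pow_add, Real.sq_sqrt (by norm_num)]
  ring

lemma fac_cs (j m : ℕ) : fac j (m+1) ^ 2 ≤ fac j m * fac j (m+2) := by
  unfold fac
  set x : ℝ := ((m:ℝ) + j + 1) / 2 with hx
  have hx0 : 0 < x := by positivity
  have h1 : (((m+1 : ℕ):ℝ) + j + 1) / 2 = 1/2 * x + 1/2 * (x + 1) := by rw [hx]; push_cast; ring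
  have h2 : (((m+2 : ℕ):ℝ) + j + 1) / 2 = x + 1 := by rw [hx]; push_cast; ring
  rw [h1, h2]
  have h := Real.Gamma_mul_add_mul_le_rpow_Gamma_mul_rpow_Gamma hx0
    (by positivity : 0 < x + 1) (by norm_num : (0:ℝ) < 1/2) (by norm_num : (0:ℝ) < 1/2)
    (by norm_num)
  have g1 := Real.Gamma_pos_of_pos hx0
  have g2 := Real.Gamma_pos_of_pos (by positivity : 0 < x + 1)
  have g3 := Real.Gamma_pos_of_pos (by positivity : 0 < 1/2 * x + 1/2 * (x + 1))
  have g4 := Real.Gamma_pos_of_pos (s := ((j:ℝ) + 1) / 2) (by positivity)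
  rw [← Real.sqrt_eq_rpow, ← Real.sqrt_eq_rpow, ← Real.sqrt_mul g1.le] at h
  have h3 : Real.Gamma (1/2 * x + 1/2 * (x + 1)) ^ 2 ≤ Real.Gamma x * Real.Gamma (x + 1) := by
    calc _ ≤ √(Real.Gamma x * Real.Gamma (x + 1)) ^ 2 := by gcongr
      _ = _ := Real.sq_sqrt (by positivity)
  calc _ = (√2 ^ (m+1)) ^ 2 / Real.Gamma (((j:ℝ) + 1) / 2) ^ 2 *
        Real.Gamma (1/2 * x + 1/2 * (x + 1)) ^ 2 := by ring
    _ ≤ (√2 ^ (m+1)) ^ 2 / Real.Gamma (((j:ℝ) + 1) / 2) ^ 2 *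
        (Real.Gamma x * Real.Gamma (x + 1)) := by gcongr
    _ = _ := by ring

noncomputable def J (n m : ℕ) : ℝ := K n * ∏ j ∈ Finset.range n, fac j m

lemma J_rec (n m : ℕ) : J n (m+2) = P n m * J n m := by
  unfold J P
  simp only [fac_rec, Finset.prod_mul_distrib]; ring

lemma J_cs (n m : ℕ) : J n (m+1) ^ 2 ≤ J n m * J n (m+2) := by
  unfold J
  calc _ = K n ^ 2 * ∏ j ∈ Finset.range n, fac j (m+1) ^ 2 := by
        rw [Finset.prod_pow]; ring
    _ ≤ K n ^ 2 * ∏ j ∈ Finset.range n, (fac j m * fac j (m+2)) := by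
        gcongr with j hj
        exact fac_cs j m
    _ = _ := by rw [Finset.prod_mul_distrib]; ring

lemma J_zero (n : ℕ) : J n 0 = K n := by
  unfold J
  rw [Finset.prod_eq_one, mul_one]
  intro j _
  unfold fac
  have g4 := Real.Gamma_pos_of_pos (s := ((j:ℝ) + 1) / 2) (by positivity)
  simp [g4.ne']

lemma P_one (n : ℕ) : P n 1 = (n+1).factorial := by
  induction n with
  | zero => simp [P]
  | succ n ih =>
    unfold P at *
    rw [Finset.prod_range_succ, ih, Nat.factorial_succ (n+1)]
    push_cast; ring

lemma J_one_succ (n : ℕ) : J (n+1) 1 = P n 1 * J n 1 := by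
  unfold J
  rw [K_succ, Finset.prod_range_succ, P_one]
  have hd := Real.Gamma_mul_Gamma_add_half (((n:ℝ) + 2) / 2)
  rw [show 2 * (((n:ℝ) + 2) / 2) = ((n+1:ℕ):ℝ) + 1 by push_cast; ring,
    Real.Gamma_nat_eq_factorial] at hd
  have g4 := Real.Gamma_pos_of_pos (s := ((n:ℝ) + 1) / 2) (by positivity)
  have key : (2:ℝ) ^ ((n:ℝ) + 1/2) / √π *
    (Real.Gamma (((n:ℝ)+1)/2) * Real.Gamma (((n:ℝ)+1)/2 + 1)) * fac n 1 = (n+1).factorial := by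
    unfold fac
    rw [show (((1:ℕ):ℝ) + n + 1) / 2 = ((n:ℝ) + 2) / 2 by push_cast; ring,
      show ((n:ℝ)+1)/2 + 1 = ((n:ℝ) + 2) / 2 + 1/2 by ring, pow_one]
    have hpi : √π ≠ 0 := by positivity
    have h2 : (2:ℝ) ^ ((n:ℝ) + 1/2) * √2 * (2:ℝ) ^ (1 - (((n+1:ℕ):ℝ) + 1)) = 1 := by
      rw [Real.sqrt_eq_rpow, ← Real.rpow_add two_pos, ← Real.rpow_add two_pos]
      rw [show (n:ℝ) + 1/2 + 1/2 + (1 - (((n+1:ℕ):ℝ) + 1)) = 0 by push_cast; ring, Real.rpow_zero]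
    calc _ = (2:ℝ) ^ ((n:ℝ) + 1/2) * √2 / √π *
          (Real.Gamma (((n:ℝ) + 2) / 2) * Real.Gamma (((n:ℝ) + 2) / 2 + 1/2)) := by
          field_simp
      _ = ((2:ℝ) ^ ((n:ℝ) + 1/2) * √2 * (2:ℝ) ^ (1 - (((n+1:ℕ):ℝ) + 1))) * (n+1).factorial := by
          rw [hd]; field_simp
      _ = _ := by rw [h2, one_mul]
  linear_combination (K n * ∏ j ∈ Finset.range n, fac j 1) * key

lemma A_one (n : ℕ) : A n 1 ∅ = J n 1 := by
  induction n with
  | zero =>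
    have ho : orth 0 = Set.univ := by ext σ; simp [orth]
    simp [A, J, K, B, E, D, ho]
    simp [Measure.real, volume_pi]
  | succ n ih => rw [A_bdry, A_rec n 1, J_one_succ, ih]

lemma main (n : ℕ) : A n 0 ∅ = K n := by
  rw [← J_zero]
  exact uniq n (fun m => A n m ∅) (J n) (A_rec n) (J_rec n) (A_cs n) (J_cs n) (A_one n)
    (A_nonneg n 0) (by rw [J_zero]; exact (K_pos n).le)

end SelAux

theorem selberg_singular_values_normalization (n : ℕ) (hn : 1 ≤ n) :
    (∫ σ in {σ : Fin n → ℝ | ∀ i, 0 < σ i},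
        Real.exp (-(∑ i, σ i ^ 2) / 2) *
          ∏ p ∈ Finset.univ.filter (fun p : Fin n × Fin n => p.1 < p.2),
            |σ p.1 ^ 2 - σ p.2 ^ 2|) =
      (2 : ℝ) ^ (((n ^ 2 : ℕ) : ℝ) / 2) / π ^ ((n : ℝ) / 2) *
        ∏ j ∈ Finset.Icc 1 n, Real.Gamma ((j : ℝ) / 2) * Real.Gamma ((j : ℝ) / 2 + 1) := by
  have h := SelAux.main n
  unfold SelAux.A SelAux.B SelAux.K at h
  simp only [Finset.prod_empty, pow_zero, one_mul] at h
  exact h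
end

section
/- Let m ≥ 0 and μ ≥ 1. The expectation of |det Q|^μ for Q a GOE(2m+1) random matrix equals Γ((μ+1)/2) · 2^{(μ+1)/2} · (2π)^{-1/2} · ∏_{i=0}^{m-1} Γ(i+μ+3/2)/Γ(i+3/2). -/
open Finset Real MeasureTheory

namespace GOE

/-- constant identity -/
lemma const_identity (m : ℕ) :
    (2 * π) ^ (-((2 * m + 1 : ℕ) : ℝ) / 2) *
      (∏ j ∈ Finset.Icc 1 (2 * m + 1), Real.Gamma (3 / 2) / Real.Gamma (1 + (j : ℝ) / 2)) *
      (((2 * m + 1).factorial : ℝ) * 2 ^ m * ∏ i ∈ Finset.range m, (i.factorial : ℝ)) =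
    (2 * π) ^ (-(1 : ℝ) / 2) * ∏ i ∈ Finset.range m, (Real.Gamma ((i : ℝ) + 3 / 2))⁻¹ := by
  have hG : Real.Gamma (3 / 2) = √π / 2 := by
    rw [show (3 / 2 : ℝ) = 1 / 2 + 1 by norm_num, Real.Gamma_add_one (by norm_num),
      Real.Gamma_one_half_eq]
    ring
  induction m with
  | zero =>
    simp
    rw [show (1 : ℝ) + 2⁻¹ = 3 / 2 by norm_num, div_self (by rw [hG]; positivity)]
    simp
  | succ m ih =>
    have h1 : (2 * π) ^ (-((2 * (m + 1) + 1 : ℕ) : ℝ) / 2) =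
        (2 * π) ^ (-((2 * m + 1 : ℕ) : ℝ) / 2) * (2 * π)⁻¹ := by
      rw [← Real.rpow_neg_one, ← Real.rpow_add (by positivity)]
      congr 1
      push_cast
      ring
    have h2 : Real.Gamma (1 + ((2 * m + 2 : ℕ) : ℝ) / 2) = (m + 1) * (m.factorial : ℝ) := by
      rw [show (1 + ((2 * m + 2 : ℕ) : ℝ) / 2) = ((m + 1 : ℕ) : ℝ) + 1 by push_cast; ring,
        Real.Gamma_nat_eq_factorial, Nat.factorial_succ]
      push_cast
      ring
    have h3 : Real.Gamma (1 + ((2 * m + 3 : ℕ) : ℝ) / 2) =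
        (m + 3 / 2) * Real.Gamma ((m : ℝ) + 3 / 2) := by
      rw [← Real.Gamma_add_one (by positivity)]
      congr 1
      push_cast
      ring
    have h4 : 0 < Real.Gamma ((m : ℝ) + 3 / 2) := Real.Gamma_pos_of_pos (by positivity)
    have h5 : (((2 * (m + 1) + 1).factorial : ℕ) : ℝ) =
        (2 * m + 3) * (2 * m + 2) * ((2 * m + 1).factorial : ℝ) := by
      rw [show 2 * (m + 1) + 1 = (2 * m + 1) + 1 + 1 by ring, Nat.factorial_succ,
        Nat.factorial_succ]
      push_cast
      ring
    rw [h1, h5, show 2 * (m + 1) + 1 = (2 * m + 1) + 1 + 1 by ring,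
      Finset.prod_Icc_succ_top (by omega), Finset.prod_Icc_succ_top (by omega),
      Finset.prod_range_succ, Finset.prod_range_succ, h2, h3, ← mul_assoc ((2 * π) ^ (-(1:ℝ) / 2)), ← ih, hG, pow_succ]
    have hs : √π * √π = π := Real.mul_self_sqrt (by positivity)
    have : (0 : ℝ) < m.factorial := by positivity
    have hm3 : (m : ℝ) + 3 / 2 ≠ 0 := by positivity
    have key : (2 * π)⁻¹ * ((√π / 2 / ((m + 1) * (m.factorial : ℝ))) *
        (√π / 2 / ((m + 3 / 2) * Real.Gamma ((m : ℝ) + 3 / 2)))) *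
        ((2 * m + 3) * (2 * m + 2)) * 2 * m.factorial = (Real.Gamma ((m : ℝ) + 3 / 2))⁻¹ := by
      have : (2 * π)⁻¹ * ((√π / 2 / ((m + 1) * (m.factorial : ℝ))) *
        (√π / 2 / ((m + 3 / 2) * Real.Gamma ((m : ℝ) + 3 / 2)))) *
        ((2 * m + 3) * (2 * m + 2)) * 2 * m.factorial
        = (2 * π)⁻¹ * (((√π * √π) / 4 / ((m + 1) * (m.factorial : ℝ))) *
        (1 / ((m + 3 / 2) * Real.Gamma ((m : ℝ) + 3 / 2)))) *
        ((2 * m + 3) * (2 * m + 2)) * 2 * m.factorial := by ring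
      rw [this, hs]
      field_simp
      ring
    rw [← key]
    ring

lemma hankel (m : ℕ) (a : ℝ) (ha : 0 < a) :
    (Matrix.of fun b c : Fin m => Real.Gamma (a + b + c)).det =
      ∏ i ∈ Finset.range m, ((i.factorial : ℝ) * Real.Gamma (a + i)) := by
  have h : (Matrix.of fun b c : Fin m => Real.Gamma (a + b + c)) =
      Matrix.of fun b c : Fin m => Real.Gamma (a + b) *
        (Matrix.of fun b c : Fin m => (ascPochhammer ℝ (c : ℕ)).eval ((b : ℝ) + a)) b c := by
    ext b c
    simp only [Matrix.of_apply]
    generalize (c : ℕ) = k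
    induction k with
    | zero => simp
    | succ k ih =>
      rw [ascPochhammer_succ_eval, ← mul_assoc, ← ih]
      push_cast
      rw [← add_assoc, Real.Gamma_add_one (by positivity)]
      ring
  rw [h, Matrix.det_mul_column, ← Matrix.det_eval_matrixOfPolynomials_eq_det_vandermonde
    (fun b : Fin m => (b : ℝ) + a) (fun c => ascPochhammer ℝ (c : ℕ))
    (fun i => ascPochhammer_natDegree _ _) (fun i => monic_ascPochhammer ℝ _),
    Matrix.det_vandermonde_add, Finset.prod_mul_distrib, mul_comm,
    ← Fin.prod_univ_eq_prod_range (fun i => Real.Gamma (a + i))]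
  congr 1
  cases m with
  | zero => simp
  | succ n =>
    rw [Matrix.det_vandermonde_id_eq_superFactorial, ← Nat.prod_range_succ_factorial]
    push_cast
    rfl

/-- ordered region -/
def D (n : ℕ) : Set (Fin n → ℝ) := {x | StrictMono fun i => |x i|}

lemma measurableSet_D (n : ℕ) : MeasurableSet (D n) := by
  have : D n = ⋂ i : Fin n, ⋂ j : Fin n, ⋂ _ : i < j, {x : Fin n → ℝ | |x i| < |x j|} := by
    ext x
    simp only [D, StrictMono, Set.mem_ofPred_eq, Set.mem_iInter]
  rw [this]
  refine MeasurableSet.iInter fun i => MeasurableSet.iInter fun j => MeasurableSet.iInter fun _ => ?_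
  exact measurableSet_lt (by fun_prop) (by fun_prop)

lemma ae_injective (n : ℕ) : ∀ᵐ x : Fin n → ℝ, Function.Injective fun i => |x i| := by
  have key : ∀ (i j : Fin n) (s : ℝ), i ≠ j → ∀ᵐ x : Fin n → ℝ, x i ≠ s * x j := by
    intro i j s hij
    let S : Submodule ℝ (Fin n → ℝ) :=
      LinearMap.ker ((LinearMap.proj i : (Fin n → ℝ) →ₗ[ℝ] ℝ) - s • LinearMap.proj j)
    have hS : S ≠ ⊤ := by
      intro h
      have : (Pi.single i 1 : Fin n → ℝ) ∈ S := h ▸ Submodule.mem_top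
      simp [S, hij.symm] at this
    have := Measure.addHaar_submodule (volume : Measure (Fin n → ℝ)) S hS
    rw [ae_iff]
    convert this using 2
    ext x
    simp [S, sub_eq_zero]
  have : ∀ᵐ x : Fin n → ℝ, ∀ i j : Fin n, i ≠ j → x i ≠ 1 * x j ∧ x i ≠ (-1) * x j := by
    rw [ae_all_iff]; intro i
    rw [ae_all_iff]; intro j
    by_cases hij : i = j
    · simp [hij]
    · filter_upwards [key i j 1 hij, key i j (-1) hij] with x h1 h2 _ using ⟨h1, h2⟩
  filter_upwards [this] with x hx i j hij
  by_contra hne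
  obtain ⟨h1, h2⟩ := hx i j hne
  rcases abs_eq_abs.mp hij with h | h
  · exact h1 (by simpa using h)
  · exact h2 (by simpa using h)

lemma piCongrLeft_eq {ι κ : Type*} (e : ι ≃ κ) (x : κ → ℝ) :
    MeasurableEquiv.piCongrLeft (fun _ : ι => ℝ) e.symm x = fun i => x (e i) := by
  ext i
  obtain ⟨j, rfl⟩ := e.symm.surjective i
  rw [MeasurableEquiv.coe_piCongrLeft, Equiv.piCongrLeft_apply_apply, Equiv.apply_symm_apply]

lemma integral_perm {ι κ : Type*} [Fintype ι] [Fintype κ] (e : ι ≃ κ) (F : (ι → ℝ) → ℝ) :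
    ∫ x : κ → ℝ, F (fun i => x (e i)) = ∫ x, F x := by
  have h := volume_measurePreserving_piCongrLeft (fun _ : ι => ℝ) e.symm
  rw [← h.integral_comp']
  simp_rw [piCongrLeft_eq]

lemma integrable_perm {ι κ : Type*} [Fintype ι] [Fintype κ] (e : ι ≃ κ) (F : (ι → ℝ) → ℝ)
    (hF : Integrable F) : Integrable (fun x : κ → ℝ => F (fun i => x (e i))) := by
  have h := volume_measurePreserving_piCongrLeft (fun _ : ι => ℝ) e.symm
  have h2 := (h.integrable_comp_emb (MeasurableEquiv.measurableEmbedding _)).2 hF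
  refine h2.congr (Filter.Eventually.of_forall fun x => ?_)
  simp only [Function.comp, piCongrLeft_eq]

lemma sort_sum {n : ℕ} (F : (Fin n → ℝ) → ℝ) (hF : Integrable F) :
    ∫ x, F x = ∫ x in D n, ∑ σ : Equiv.Perm (Fin n), F (fun i => x (σ i)) := by
  have hint : ∀ σ : Equiv.Perm (Fin n), Integrable (fun x : Fin n → ℝ => F (fun i => x (σ i))) := by
    intro σ
    exact integrable_perm σ F hF
  rw [integral_finsetSum _ (fun σ _ => (hint σ).integrableOn)]
  have h1 : ∀ σ : Equiv.Perm (Fin n), ∫ x in D n, F (fun i => x (σ i)) =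
      ∫ x, (D n).indicator (fun _ => (1 : ℝ)) (fun i => x (σ.symm i)) * F x := by
    intro σ
    rw [← integral_indicator (measurableSet_D n),
      ← integral_perm σ (fun x => (D n).indicator (fun _ => (1 : ℝ)) (fun i => x (σ.symm i)) * F x)]
    congr 1
    ext x
    by_cases hx : x ∈ D n <;> simp [hx]
  simp_rw [h1]
  rw [← integral_finsetSum]
  · apply integral_congr_ae
    filter_upwards [ae_injective n] with x hx
    rw [← Finset.sum_mul]
    suffices h : ∑ σ : Equiv.Perm (Fin n),
        (D n).indicator (fun _ => (1 : ℝ)) (fun i => x (σ.symm i)) = 1 by rw [h, one_mul]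
    set f : Fin n → ℝ := fun i => |x i| with hf
    rw [Finset.sum_eq_single (Tuple.sort f).symm]
    · rw [Set.indicator_of_mem]
      have hm := Tuple.monotone_sort f
      exact hm.strictMono_of_injective (hx.comp (Tuple.sort f).injective)
    · intro σ _ hσ
      rw [Set.indicator_of_notMem]
      intro hmem
      apply hσ
      have h2 : StrictMono (f ∘ σ.symm) := hmem
      have h3 := Tuple.unique_monotone h2.monotone (Tuple.monotone_sort f)
      ext i
      have : σ.symm = Tuple.sort f := by
        ext i
        exact congrArg Fin.val (hx (congrFun h3 i))
      rw [← this]; simp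
    · simp
  · intro σ _
    refine hF.bdd_mul (c := 1) ?_ ?_
    · apply Measurable.aestronglyMeasurable
      exact (measurable_const.indicator (measurableSet_D n)).comp (by fun_prop)
    · refine Filter.Eventually.of_forall fun x => ?_
      by_cases h : (fun i => x (σ.symm i)) ∈ D n <;> simp [h]

lemma det_integrable {ι κ : Type*} [Fintype ι] [DecidableEq ι] [Fintype κ] [DecidableEq κ]
    (f : ι → ι ⊕ κ → ℝ → ℝ) (hf : ∀ a k, Integrable (f a k)) (G : κ → ι ⊕ κ → ℝ) :
    Integrable (fun x : ι → ℝ =>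
      (Matrix.of (Sum.elim (fun a k => f a k (x a)) G)).det) := by
  simp_rw [← Matrix.det_transpose (Matrix.of _), Matrix.det_apply', Fintype.prod_sum_type,
    Matrix.transpose_apply, Matrix.of_apply, Sum.elim_inl, Sum.elim_inr]
  refine integrable_finsetSum _ fun σ _ => Integrable.const_mul (Integrable.mul_const ?_ _) _
  exact Integrable.fintype_prod fun a => hf a _

lemma det_integral {ι κ : Type*} [Fintype ι] [DecidableEq ι] [Fintype κ] [DecidableEq κ]
    (f : ι → ι ⊕ κ → ℝ → ℝ) (hf : ∀ a k, Integrable (f a k)) (G : κ → ι ⊕ κ → ℝ) :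
    ∫ x : ι → ℝ, (Matrix.of (Sum.elim (fun a k => f a k (x a)) G)).det =
      (Matrix.of (Sum.elim (fun a k => ∫ t, f a k t) G)).det := by
  simp_rw [← Matrix.det_transpose (Matrix.of _), Matrix.det_apply', Fintype.prod_sum_type,
    Matrix.transpose_apply, Matrix.of_apply, Sum.elim_inl, Sum.elim_inr]
  rw [integral_finsetSum]
  · refine Finset.sum_congr rfl fun σ _ => ?_
    rw [integral_const_mul, integral_mul_const,
      integral_fintype_prod_volume_eq_prod (fun a t => f a (σ (Sum.inl a)) t)]
  · intro σ _
    refine Integrable.const_mul (Integrable.mul_const ?_ _) _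
    exact Integrable.fintype_prod fun a => hf a _

lemma det_integrable' {ι : Type*} [Fintype ι] [DecidableEq ι]
    (f : ι → ι → ℝ → ℝ) (hf : ∀ a k, Integrable (f a k)) :
    Integrable (fun x : ι → ℝ => (Matrix.of (fun a k => f a k (x a))).det) := by
  simp_rw [← Matrix.det_transpose (Matrix.of _), Matrix.det_apply',
    Matrix.transpose_apply, Matrix.of_apply]
  refine integrable_finsetSum _ fun σ _ => Integrable.const_mul ?_ _
  exact Integrable.fintype_prod fun a => hf a _

lemma det_integral' {ι : Type*} [Fintype ι] [DecidableEq ι]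
    (f : ι → ι → ℝ → ℝ) (hf : ∀ a k, Integrable (f a k)) :
    ∫ x : ι → ℝ, (Matrix.of (fun a k => f a k (x a))).det =
      (Matrix.of (fun a k => ∫ t, f a k t)).det := by
  simp_rw [← Matrix.det_transpose (Matrix.of _), Matrix.det_apply',
    Matrix.transpose_apply, Matrix.of_apply]
  rw [integral_finsetSum]
  · refine Finset.sum_congr rfl fun σ _ => ?_
    rw [integral_const_mul, integral_fintype_prod_volume_eq_prod (fun a t => f a (σ a) t)]
  · intro σ _
    refine Integrable.const_mul ?_ _
    exact Integrable.fintype_prod fun a => hf a _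

/-- Andreief on the ordered region -/
lemma andreief {n : ℕ} (g : Fin n → ℝ → ℝ) (hg : ∀ a b, Integrable (fun t => g a t * g b t)) :
    ∫ y in D n, (Matrix.of fun a b => g b (y a)).det ^ 2 =
      (Matrix.of fun a b => ∫ t, g a t * g b t).det := by
  rw [← det_integral' (fun a b t => g a t * g b t) hg, sort_sum _ (det_integrable' _ hg)]
  congr 1
  ext y
  have : ∀ σ : Equiv.Perm (Fin n),
      (Matrix.of fun a k => g a (y (σ a)) * g k (y (σ a))).det =
      (Equiv.Perm.sign σ : ℝ) * (∏ a, g a (y (σ a))) * (Matrix.of fun a b => g b (y a)).det := by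
    intro σ
    have h1 := Matrix.det_mul_column (fun a => g a (y (σ a)))
      ((Matrix.of fun a b => g b (y a)).submatrix σ id)
    rw [Matrix.det_permute] at h1
    calc _ = _ := h1
      _ = _ := by ring
  simp_rw [this, ← Finset.sum_mul]
  rw [sq]
  congr 1
  rw [Matrix.det_apply']
  rfl


lemma integrable_gauss {b : ℝ} (hb : 0 < b) (k : ℕ) :
    Integrable fun x : ℝ => |x| ^ k * Real.exp (-b * x ^ 2) := by
  have h := integrable_rpow_mul_exp_neg_mul_sq hb (s := (k : ℝ))
    (lt_of_lt_of_le (by norm_num) (Nat.cast_nonneg k))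
  refine h.norm.congr (Filter.Eventually.of_forall fun x => ?_)
  simp [abs_of_pos (Real.exp_pos _)]

lemma integral_gauss {b : ℝ} (hb : 0 < b) (k : ℕ) :
    ∫ x : ℝ, |x| ^ k * Real.exp (-b * x ^ 2) =
      b ^ (-((k : ℝ) + 1) / 2) * Real.Gamma (((k : ℝ) + 1) / 2) := by
  have h := integral_comp_abs (f := fun x : ℝ => x ^ k * Real.exp (-b * x ^ 2))
  simp only [sq_abs] at h
  rw [h]
  have h2 := integral_rpow_mul_exp_neg_mul_rpow (p := 2) (q := (k : ℝ)) (b := b) (by norm_num)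
    (lt_of_lt_of_le (by norm_num) (Nat.cast_nonneg k)) hb
  simp only [Real.rpow_natCast, Real.rpow_ofNat] at h2
  rw [h2]
  ring

/-- weight -/
noncomputable def w (μ : ℕ) (x : ℝ) : ℝ := |x| ^ μ * Real.exp (-x ^ 2 / 2)

/-- sign with values 1 and -1 -/
noncomputable def sg (x : ℝ) : ℝ := if x < 0 then -1 else 1

lemma sg_sq (x : ℝ) : sg x ^ 2 = 1 := by
  unfold sg; split_ifs <;> norm_num

lemma abs_sg (x : ℝ) : |sg x| = 1 := by
  unfold sg; split_ifs <;> norm_num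

lemma sg_mul (x : ℝ) : sg x * x = |x| := by
  unfold sg; split_ifs with h
  · rw [abs_of_neg h]; ring
  · rw [abs_of_nonneg (not_lt.mp h)]; ring

lemma measurable_sg : Measurable sg :=
  Measurable.ite measurableSet_Iio measurable_const measurable_const

lemma measurable_w (μ : ℕ) : Measurable (w μ) := by
  unfold w; fun_prop

lemma w_nonneg (μ : ℕ) (x : ℝ) : 0 ≤ w μ x := by unfold w; positivity

lemma integrable_w (μ j k : ℕ) : Integrable fun t => w μ t * (sg t ^ j * t ^ k) := by
  refine (integrable_gauss (b := 1 / 2) (by norm_num) (μ + k)).mono ?_ ?_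
  · have := measurable_w μ
    have := measurable_sg
    exact Measurable.aestronglyMeasurable (by fun_prop)
  · refine Filter.Eventually.of_forall fun x => le_of_eq ?_
    simp only [w, norm_mul, norm_pow, Real.norm_eq_abs, abs_sg, abs_abs, one_pow, one_mul, pow_add,
      abs_of_pos (Real.exp_pos _)]
    rw [show -x ^ 2 / 2 = -(1 / 2) * x ^ 2 by ring]
    ring

lemma integrable_w' (μ k : ℕ) : Integrable fun t => w μ t * t ^ k := by
  simpa using integrable_w μ 0 k

lemma w_mul_even (μ k : ℕ) (t : ℝ) :
    w μ t * t ^ (2 * k) = |t| ^ (μ + 2 * k) * Real.exp (-(1 / 2) * t ^ 2) := by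
  rw [w, pow_add, pow_mul |t|, sq_abs, ← pow_mul, show -t ^ 2 / 2 = -(1 / 2) * t ^ 2 by ring]
  ring

lemma total (μ k : ℕ) : ∫ t, w μ t * t ^ (2 * k) =
    2 ^ (((μ : ℝ) + 2 * k + 1) / 2) * Real.Gamma (((μ : ℝ) + 2 * k + 1) / 2) := by
  simp_rw [w_mul_even]
  rw [integral_gauss (by norm_num)]
  push_cast
  rw [one_div, Real.inv_rpow (by norm_num), ← Real.rpow_neg (by norm_num), neg_div, neg_neg]

lemma total_succ (μ k : ℕ) : ∫ t, w μ t * t ^ (2 * (k + 1)) =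
    (2 * k + 1 + μ) * ∫ t, w μ t * t ^ (2 * k) := by
  rw [total, total]
  have h : ((μ : ℝ) + 2 * (k + 1 : ℕ) + 1) / 2 = ((μ : ℝ) + 2 * k + 1) / 2 + 1 := by
    push_cast; ring
  rw [h, Real.Gamma_add_one (by positivity), Real.rpow_add_one (by norm_num)]
  ring

lemma trunc (μ k : ℕ) (r : ℝ) (hr : 0 ≤ r) : ∫ t in {t | |t| ≤ r}, w μ t * t ^ (2 * k) =
    2 * ∫ t in (0 : ℝ)..r, t ^ (μ + 2 * k) * Real.exp (-(1 / 2) * t ^ 2) := by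
  have hm : MeasurableSet {t : ℝ | |t| ≤ r} := measurableSet_le (by fun_prop) (by fun_prop)
  rw [← integral_indicator hm, intervalIntegral.integral_of_le hr]
  have h := integral_comp_abs
    (f := (Set.Iic r).indicator fun t : ℝ => t ^ (μ + 2 * k) * Real.exp (-(1 / 2) * t ^ 2))
  rw [setIntegral_indicator measurableSet_Iic, Set.Ioi_inter_Iic] at h
  rw [← h]
  congr 1
  ext t
  simp_rw [w_mul_even]
  by_cases ht : |t| ≤ r <;> simp [ht]

lemma trunc_succ (μ k : ℕ) (r : ℝ) (hr : 0 ≤ r) :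
    ∫ t in {t | |t| ≤ r}, w μ t * t ^ (2 * (k + 1)) =
      -2 * (w μ r * r ^ (2 * k + 1)) +
      (2 * k + 1 + μ) * ∫ t in {t | |t| ≤ r}, w μ t * t ^ (2 * k) := by
  rw [trunc μ _ r hr, trunc μ _ r hr]
  have hd : ∀ x ∈ Set.uIcc 0 r, HasDerivAt
      (fun x : ℝ => x ^ (μ + 2 * k + 1) * Real.exp (-(1 / 2) * x ^ 2))
      ((2 * k + 1 + μ) * (x ^ (μ + 2 * k) * Real.exp (-(1 / 2) * x ^ 2)) -
        x ^ (μ + 2 * (k + 1)) * Real.exp (-(1 / 2) * x ^ 2)) x := by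
    intro x _
    have h1 := hasDerivAt_pow (μ + 2 * k + 1) x
    have h2 := (((hasDerivAt_pow 2 x).const_mul (-(1 / 2) : ℝ))).exp
    convert! h1.mul h2 using 1
    push_cast
    ring
  have h := intervalIntegral.integral_eq_sub_of_hasDerivAt hd
    (Continuous.intervalIntegrable (by fun_prop) _ _)
  rw [intervalIntegral.integral_sub (Continuous.intervalIntegrable (by fun_prop) _ _)
    (Continuous.intervalIntegrable (by fun_prop) _ _), intervalIntegral.integral_const_mul] at h
  have hw : w μ r * r ^ (2 * k + 1) = r ^ (μ + 2 * k + 1) * Real.exp (-(1 / 2) * r ^ 2) := by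
    rw [w, abs_of_nonneg hr, show -r ^ 2 / 2 = -(1 / 2) * r ^ 2 by ring]
    ring
  rw [hw]
  simp only [ne_eq, Nat.add_eq_zero_iff, one_ne_zero, and_false, not_false_eq_true, zero_pow,
    zero_mul, sub_zero] at h
  linear_combination -2 * h

/-- slab between consecutive `y` -/
def S {m : ℕ} (y : Fin m → ℝ) (a : Fin (m + 1)) : Set ℝ :=
  {t | (∀ b : Fin m, b.1 + 1 = a.1 → |y b| < |t|) ∧ (∀ b : Fin m, b.1 = a.1 → |t| < |y b|)}

/-- cumulative region -/
def U {m : ℕ} (y : Fin m → ℝ) (a : Fin (m + 1)) : Set ℝ :=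
  {t | ∀ b : Fin m, b.1 = a.1 → |t| ≤ |y b|}

lemma measurableSet_S {m : ℕ} (y : Fin m → ℝ) (a : Fin (m + 1)) : MeasurableSet (S y a) := by
  have : S y a = (⋂ b : Fin m, ⋂ _ : b.1 + 1 = a.1, {t : ℝ | |y b| < |t|}) ∩
      (⋂ b : Fin m, ⋂ _ : b.1 = a.1, {t : ℝ | |t| < |y b|}) := by
    ext t
    simp only [S, Set.mem_ofPred_eq, Set.mem_iInter, Set.mem_inter_iff]
  rw [this]
  refine MeasurableSet.inter ?_ ?_ <;>
  exact MeasurableSet.iInter fun i => MeasurableSet.iInter fun _ =>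
    measurableSet_lt (by fun_prop) (by fun_prop)

lemma U_last {m : ℕ} (y : Fin m → ℝ) : U y (Fin.last m) = Set.univ := by
  ext t
  simp only [U, Fin.val_last, Set.mem_ofPred_eq, Set.mem_univ, iff_true]
  intro b hb
  exact absurd hb b.isLt.ne

lemma U_castSucc {m : ℕ} (y : Fin m → ℝ) (a : Fin m) : U y a.castSucc = {t | |t| ≤ |y a|} := by
  ext t
  simp only [U, Fin.val_castSucc, Set.mem_ofPred_eq]
  constructor
  · intro h; exact h a rfl
  · intro h b hb
    rw [Fin.ext hb]; exact h

lemma measurableSet_U {m : ℕ} (y : Fin m → ℝ) (a : Fin (m + 1)) : MeasurableSet (U y a) := by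
  refine Fin.lastCases ?_ (fun a => ?_) a
  · rw [U_last]; exact MeasurableSet.univ
  · rw [U_castSucc]; exact measurableSet_le (by fun_prop) (by fun_prop)

lemma ae_abs_ne (r : ℝ) : ∀ᵐ t : ℝ, |t| ≠ r := by
  have : ∀ᵐ t : ℝ, t ∉ ({r, -r} : Set ℝ) :=
    Set.Countable.ae_notMem (Set.toFinite _).countable _
  filter_upwards [this] with t ht h
  apply ht
  rcases abs_choice t with h' | h'
  · left; linarith
  · right; simp; linarith

lemma row_succ {m : ℕ} (y : Fin m → ℝ) (hy : y ∈ D m) (a : Fin m) (f : ℝ → ℝ)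
    (hf : Integrable f) :
    ∫ t in U y a.succ, f t = (∫ t in S y a.succ, f t) + ∫ t in U y a.castSucc, f t := by
  rw [← setIntegral_union ?_ (measurableSet_U _ _) hf.integrableOn hf.integrableOn]
  · apply setIntegral_congr_set
    have hne : ∀ᵐ t : ℝ, ∀ b : Fin m, |t| ≠ |y b| := by
      rw [ae_all_iff]; exact fun b => ae_abs_ne _
    filter_upwards [hne] with t ht
    refine propext ?_
    change t ∈ U y a.succ ↔ t ∈ S y a.succ ∪ U y a.castSucc
    rw [U_castSucc]
    simp only [U, S, Set.mem_union, Set.mem_ofPred_eq, Fin.val_succ]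
    constructor
    · intro h
      by_cases h1 : |t| ≤ |y a|
      · exact Or.inr h1
      · refine Or.inl ⟨fun b hb => ?_, fun b hb => lt_of_le_of_ne (h b hb) (ht b)⟩
        rw [show b = a from Fin.ext (by omega)]
        exact not_le.mp h1
    · rintro (⟨_, h⟩ | h) b hb
      · exact (h b hb).le
      · have : |y a| < |y b| := hy (Fin.lt_def.mpr (by omega))
        exact h.trans this.le
  · rw [U_castSucc, Set.disjoint_left]
    intro t ht ht2
    have := ht.1 a rfl
    exact absurd ht2 (not_le.mpr this)

lemma row_zero {m : ℕ} (y : Fin m → ℝ) (f : ℝ → ℝ) :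
    ∫ t in U y 0, f t = ∫ t in S y 0, f t := by
  apply setIntegral_congr_set
  have hne : ∀ᵐ t : ℝ, ∀ b : Fin m, |t| ≠ |y b| := by
    rw [ae_all_iff]; exact fun b => ae_abs_ne _
  filter_upwards [hne] with t ht
  refine propext ?_
  change t ∈ U y 0 ↔ t ∈ S y 0
  simp only [U, S, Set.mem_ofPred_eq, Fin.val_zero]
  constructor
  · intro h
    exact ⟨fun b hb => by omega, fun b hb => lt_of_le_of_ne (h b hb) (ht b)⟩
  · intro h b hb
    exact (h.2 b hb).le

lemma w_abs (μ : ℕ) (t : ℝ) : w μ |t| = w μ t := by simp [w]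

lemma det_inner (μ : ℕ) {m : ℕ} (y : Fin m → ℝ) (hy : y ∈ D m) :
    (Matrix.of fun a b : Fin (m + 1) => ∫ t in S y a, w μ t * t ^ (2 * (b : ℕ))).det =
      (∫ t, w μ t) * 2 ^ m *
        (Matrix.of fun a b : Fin m => w μ (y a) * |y a| ^ (2 * (b : ℕ) + 1)).det := by
  rw [← Matrix.det_eq_of_forall_row_eq_smul_add_pred
    (A := Matrix.of fun a b : Fin (m + 1) => ∫ t in U y a, w μ t * t ^ (2 * (b : ℕ)))
    (B := Matrix.of fun a b : Fin (m + 1) => ∫ t in S y a, w μ t * t ^ (2 * (b : ℕ)))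
    (fun _ => 1) (fun j => row_zero y _)
    (fun i j => by simpa using row_succ y hy i _ (integrable_w' μ _))]
  let B : Matrix (Fin (m + 1)) (Fin (m + 1)) ℝ := Matrix.of fun a b =>
    Fin.cases (∫ t in U y a, w μ t)
      (fun b => Fin.lastCases (motive := fun _ => ℝ) 0
        (fun a => -2 * (w μ (y a) * |y a| ^ (2 * (b : ℕ) + 1))) a) b
  rw [Matrix.det_eq_of_forall_col_eq_smul_add_pred (B := B)
    (fun b => 2 * ((b : ℕ) : ℝ) + 1 + μ)]
  · rw [Matrix.det_succ_row B (Fin.last m), Finset.sum_eq_single 0]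
    · have h1 : B (Fin.last m) 0 = ∫ t, w μ t := by
        simp [B, U_last]
      have h2 : B.submatrix (Fin.last m).succAbove (Fin.succAbove 0) =
          (-2 : ℝ) • Matrix.of fun a b : Fin m => w μ (y a) * |y a| ^ (2 * (b : ℕ) + 1) := by
        ext a b
        simp [B]
      rw [h1, h2, Matrix.det_smul, Fintype.card_fin]
      have : (-1 : ℝ) ^ m * (-2) ^ m = 2 ^ m := by rw [← mul_pow]; norm_num
      simp only [Fin.val_last, Fin.val_zero, add_zero]
      rw [← this]
      ring
    · intro j _ hj
      obtain ⟨b, rfl⟩ := Fin.exists_succ_eq.mpr hj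
      simp [B]
    · simp
  · intro a
    simp [B]
  · intro a b
    refine Fin.lastCases ?_ (fun a => ?_) a
    · simp only [B, Matrix.of_apply, U_last, Measure.restrict_univ, Fin.cases_succ,
        Fin.lastCases_last, Fin.val_succ, Fin.val_castSucc, zero_add]
      exact total_succ μ b
    · simp only [B, Matrix.of_apply, U_castSucc, Fin.cases_succ,
        Fin.lastCases_castSucc, Fin.val_succ, Fin.val_castSucc]
      rw [trunc_succ μ b _ (abs_nonneg _), w_abs]

lemma odd_zero (μ : ℕ) {m : ℕ} (y : Fin m → ℝ) (a : Fin (m + 1)) (k : ℕ) :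
    ∫ t in S y a, w μ t * t ^ (2 * k + 1) = 0 := by
  rw [← integral_indicator (measurableSet_S y a)]
  set f := (S y a).indicator fun t => w μ t * t ^ (2 * k + 1) with hf
  have h := integral_neg_eq_self f volume
  have h2 : ∀ t, f (-t) = - f t := by
    intro t
    have hS : -t ∈ S y a ↔ t ∈ S y a := by simp [S]
    have hw : w μ (-t) = w μ t := by simp [w]
    by_cases ht : t ∈ S y a
    · rw [hf, Set.indicator_of_mem ht, Set.indicator_of_mem (hS.2 ht), hw, Odd.neg_pow ⟨k, rfl⟩]
      ring
    · rw [hf, Set.indicator_of_notMem ht, Set.indicator_of_notMem (fun h => ht (hS.1 h))]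
      ring
  simp_rw [h2, integral_neg] at h
  linarith


lemma abs_sub_eq (u v : ℝ) (h : |u| < |v|) : |v - u| = sg v * (v - u) := by
  unfold sg
  have h1 := neg_abs_le u
  have h2 := le_abs_self u
  split_ifs with hv
  · rw [abs_of_neg hv] at h
    rw [abs_of_neg (by linarith)]; ring
  · rw [abs_of_nonneg (not_lt.mp hv)] at h
    rw [abs_of_nonneg (by linarith)]; ring

lemma abs_vandermonde {n : ℕ} (x : Fin n → ℝ) (hx : x ∈ D n) :
    |(Matrix.vandermonde x).det| = (∏ i, sg (x i) ^ (i : ℕ)) * (Matrix.vandermonde x).det := by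
  rw [Matrix.det_vandermonde, Finset.abs_prod]
  simp_rw [Finset.abs_prod]
  have h1 : ∀ i : Fin n, ∏ j ∈ Finset.Ioi i, |x j - x i| =
      (∏ j ∈ Finset.Ioi i, sg (x j)) * ∏ j ∈ Finset.Ioi i, (x j - x i) := by
    intro i
    rw [← Finset.prod_mul_distrib]
    refine Finset.prod_congr rfl fun j hj => abs_sub_eq _ _ (hx (Finset.mem_Ioi.mp hj))
  simp_rw [h1, Finset.prod_mul_distrib]
  congr 1
  rw [Finset.prod_comm' (t' := Finset.univ) (s' := fun j => Finset.Iio j) (by simp)]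
  refine Finset.prod_congr rfl fun j _ => ?_
  simp

/-- the integrand -/
noncomputable def h (μ n : ℕ) (x : Fin n → ℝ) : ℝ :=
  |(Matrix.of fun i k : Fin n => w μ (x i) * x i ^ (k : ℕ)).det|

lemma h_eq' (μ n : ℕ) (x : Fin n → ℝ) :
    h μ n x = (∏ i, w μ (x i)) * |(Matrix.vandermonde x).det| := by
  have := Matrix.det_mul_column (fun i => w μ (x i)) (Matrix.vandermonde x)
  rw [h]
  change |Matrix.det (Matrix.of fun i j => w μ (x i) * Matrix.vandermonde x i j)| = _
  rw [this, abs_mul, abs_of_nonneg (Finset.prod_nonneg fun i _ => w_nonneg _ _)]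

lemma h_eq (μ n : ℕ) (x : Fin n → ℝ) :
    (∏ i, |x i|) ^ μ * Real.exp (-(∑ i, x i ^ 2) / 2) *
      (∏ p ∈ Finset.univ.filter (fun p : Fin n × Fin n => p.1 < p.2), |x p.2 - x p.1|) =
    h μ n x := by
  rw [h_eq', Matrix.det_vandermonde, Finset.abs_prod]
  simp_rw [Finset.abs_prod]
  congr 1
  · simp_rw [w, Finset.prod_mul_distrib, Finset.prod_pow, ← Real.exp_sum]
    rw [← Finset.sum_div, Finset.sum_neg_distrib]
  · rw [Finset.prod_filter, Fintype.prod_prod_type]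
    refine Finset.prod_congr rfl fun i _ => ?_
    rw [← Finset.prod_filter]
    refine Finset.prod_congr ?_ fun _ _ => rfl
    ext j; simp

/-- the integrand without absolute value -/
noncomputable def K (μ n : ℕ) (x : Fin n → ℝ) : ℝ :=
  (Matrix.of fun i k : Fin n => w μ (x i) * (sg (x i) ^ (i : ℕ) * x i ^ (k : ℕ))).det

lemma h_eq_K (μ n : ℕ) (x : Fin n → ℝ) (hx : x ∈ D n) : h μ n x = K μ n x := by
  rw [h_eq', abs_vandermonde x hx, K, ← mul_assoc, ← Finset.prod_mul_distrib]
  rw [← Matrix.det_mul_column (fun i => w μ (x i) * sg (x i) ^ (i : ℕ)) (Matrix.vandermonde x)]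
  congr 1
  ext i j
  simp [Matrix.vandermonde, mul_assoc]

lemma integrable_h (μ n : ℕ) : Integrable (h μ n) :=
  (det_integrable' (fun (_ k : Fin n) t => w μ t * t ^ (k : ℕ)) fun _ _ => integrable_w' μ _).abs

lemma integrable_K (μ n : ℕ) : Integrable (K μ n) :=
  det_integrable' (fun (i k : Fin n) t => w μ t * (sg t ^ (i : ℕ) * t ^ (k : ℕ)))
    fun _ _ => integrable_w μ _ _

lemma h_perm (μ n : ℕ) (x : Fin n → ℝ) (σ : Equiv.Perm (Fin n)) :
    h μ n (fun i => x (σ i)) = h μ n x := by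
  have := Matrix.det_permute σ (Matrix.of fun i k : Fin n => w μ (x i) * x i ^ (k : ℕ))
  rw [h, h]
  change |((Matrix.of fun i k : Fin n => w μ (x i) * x i ^ (k : ℕ)).submatrix σ id).det| = _
  rw [this, abs_mul]
  rcases Int.units_eq_one_or (Equiv.Perm.sign σ) with h | h <;> simp [h]

lemma integral_h (μ n : ℕ) : ∫ x, h μ n x = n.factorial * ∫ x in D n, K μ n x := by
  rw [sort_sum _ (integrable_h μ n)]
  simp_rw [h_perm]
  rw [← integral_const_mul]
  refine setIntegral_congr_fun (measurableSet_D n) fun x hx => ?_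
  simp [Finset.card_univ, Fintype.card_perm, h_eq_K μ n x hx]

/-- even-odd splitting of indices -/
def eo (m : ℕ) : Fin (m + 1) ⊕ Fin m → Fin (2 * m + 1) :=
  Sum.elim (fun a => ⟨2 * a, by omega⟩) (fun b => ⟨2 * b + 1, by omega⟩)

lemma eo_bij (m : ℕ) : Function.Bijective (eo m) := by
  rw [Fintype.bijective_iff_injective_and_card]
  constructor
  · rintro (a | a) (b | b) hab <;> simp [eo] at hab
    · rw [Fin.ext hab]
    · omega
    · omega
    · rw [Fin.ext hab]
  · simp; ring

/-- even-odd splitting equivalence -/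
noncomputable def eoE (m : ℕ) : Fin (m + 1) ⊕ Fin m ≃ Fin (2 * m + 1) :=
  Equiv.ofBijective _ (eo_bij m)

lemma eoE_inl (m : ℕ) (a : Fin (m + 1)) : ((eoE m (Sum.inl a) : Fin _) : ℕ) = 2 * a := rfl

lemma eoE_inr (m : ℕ) (a : Fin m) : ((eoE m (Sum.inr a) : Fin _) : ℕ) = 2 * a + 1 := rfl

/-- interleaving -/
noncomputable def il {m : ℕ} (x : Fin (m + 1) → ℝ) (y : Fin m → ℝ) : Fin (2 * m + 1) → ℝ :=
  fun i => Sum.elim x y ((eoE m).symm i)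

lemma il_inl {m : ℕ} (x : Fin (m + 1) → ℝ) (y : Fin m → ℝ) (a : Fin (m + 1)) :
    il x y (eoE m (Sum.inl a)) = x a := by simp [il]

lemma il_inr {m : ℕ} (x : Fin (m + 1) → ℝ) (y : Fin m → ℝ) (a : Fin m) :
    il x y (eoE m (Sum.inr a)) = y a := by simp [il]

lemma il_mem_D {m : ℕ} (x : Fin (m + 1) → ℝ) (y : Fin m → ℝ) :
    il x y ∈ D (2 * m + 1) ↔ y ∈ D m ∧ ∀ a, x a ∈ S y a := by
  constructor
  · intro hD
    have hl : ∀ i j, eoE m i < eoE m j → |Sum.elim x y i| < |Sum.elim x y j| := by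
      intro i j hij
      have := hD hij
      simpa [il] using this
    refine ⟨fun a b hab => ?_, fun a => ⟨fun b hb => ?_, fun b hb => ?_⟩⟩
    · exact hl (Sum.inr a) (Sum.inr b) (by rw [Fin.lt_def, eoE_inr, eoE_inr]; omega)
    · exact hl (Sum.inr b) (Sum.inl a) (by rw [Fin.lt_def, eoE_inr, eoE_inl]; omega)
    · exact hl (Sum.inl a) (Sum.inr b) (by rw [Fin.lt_def, eoE_inr, eoE_inl]; omega)
  · rintro ⟨_, hS⟩
    refine Fin.strictMono_iff_lt_succ.mpr fun i => ?_
    obtain ⟨p, hp⟩ := (eoE m).surjective i.castSucc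
    obtain ⟨q, hq⟩ := (eoE m).surjective i.succ
    have hp' : ((eoE m p : Fin _) : ℕ) = i := by rw [hp]; rfl
    have hq' : ((eoE m q : Fin _) : ℕ) = i + 1 := by rw [hq]; rfl
    simp only [← hp, ← hq]
    rcases p with a | a <;> rcases q with b | b <;>
      simp only [eoE_inl, eoE_inr] at hp' hq'
    · omega
    · rw [il_inl, il_inr]
      exact (hS a).2 b (by omega)
    · rw [il_inl, il_inr]
      exact (hS b).1 a (by omega)
    · omega

lemma integral_il {m : ℕ} (F : (Fin (2 * m + 1) → ℝ) → ℝ) (hF : Integrable F) :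
    ∫ x, F x = ∫ y : Fin m → ℝ, ∫ x : Fin (m + 1) → ℝ, F (il x y) := by
  rw [← integral_perm (eoE m).symm F]
  have hF' := integrable_perm (eoE m).symm F hF
  have hv := volume_measurePreserving_sumPiEquivProdPi_symm
    (fun _ : Fin (m + 1) ⊕ Fin m => ℝ)
  have hF2 := (hv.integrable_comp_emb (MeasurableEquiv.measurableEmbedding _)).2 hF'
  rw [← hv.integral_comp']
  have heq : ∀ p : (Fin (m + 1) → ℝ) × (Fin m → ℝ),
      (MeasurableEquiv.sumPiEquivProdPi (fun _ : Fin (m + 1) ⊕ Fin m => ℝ)).symm p =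
        Sum.elim p.1 p.2 := by
    intro p
    ext (a | a) <;> rfl
  refine (integral_prod_symm _ hF2).trans ?_
  refine integral_congr_ae (Filter.Eventually.of_forall fun y => ?_)
  refine integral_congr_ae (Filter.Eventually.of_forall fun x => ?_)
  simp only [Function.comp]
  rw [heq]
  rfl

lemma inner_integral (μ m : ℕ) (y : Fin m → ℝ) :
    ∫ x : Fin (m + 1) → ℝ, (D (2 * m + 1)).indicator (K μ (2 * m + 1)) (il x y) =
      (D m).indicator (fun y => (∫ t, w μ t) * 2 ^ m *
        (Matrix.of fun a b : Fin m => w μ (y a) * |y a| ^ (2 * (b : ℕ) + 1)).det ^ 2) y := by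
  by_cases hy : y ∈ D m
  swap
  · rw [Set.indicator_of_notMem hy]
    have : ∀ x : Fin (m + 1) → ℝ,
        (D (2 * m + 1)).indicator (K μ (2 * m + 1)) (il x y) = 0 := by
      intro x
      exact Set.indicator_of_notMem (fun h => hy ((il_mem_D x y).1 h).1) _
    simp [this]
  rw [Set.indicator_of_mem hy]
  set f : Fin (m + 1) → Fin (m + 1) ⊕ Fin m → ℝ → ℝ := fun a k =>
    (S y a).indicator fun t => w μ t * t ^ ((eoE m k : Fin _) : ℕ) with hf
  set G : Fin m → Fin (m + 1) ⊕ Fin m → ℝ := fun b k =>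
    w μ (y b) * (sg (y b) ^ (2 * (b : ℕ) + 1) * y b ^ ((eoE m k : Fin _) : ℕ)) with hG
  have h1 : ∀ x : Fin (m + 1) → ℝ, (D (2 * m + 1)).indicator (K μ (2 * m + 1)) (il x y) =
      (Matrix.of (Sum.elim (fun a k => f a k (x a)) G)).det := by
    intro x
    by_cases hx : ∀ a, x a ∈ S y a
    · rw [Set.indicator_of_mem ((il_mem_D x y).2 ⟨hy, hx⟩), K,
        ← Matrix.det_submatrix_equiv_self (eoE m)]
      congr 1
      ext (a | a) k
      · simp only [Matrix.submatrix_apply, Matrix.of_apply, il_inl, eoE_inl, Sum.elim_inl, hf,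
          Set.indicator_of_mem (hx a), pow_mul (sg _), sg_sq, one_pow, one_mul]
      · simp only [Matrix.submatrix_apply, Matrix.of_apply, il_inr, eoE_inr, Sum.elim_inr, hG]
    · rw [Set.indicator_of_notMem (fun h => hx ((il_mem_D x y).1 h).2)]
      push Not at hx
      obtain ⟨a, ha⟩ := hx
      rw [Matrix.det_eq_zero_of_row_eq_zero (Sum.inl a)]
      intro k
      simp [hf, ha]
  simp_rw [h1]
  rw [det_integral f (fun a k => (integrable_w' μ _).indicator (measurableSet_S y a))]
  have h2 : Matrix.of (Sum.elim (fun a k => ∫ t, f a k t) G) = Matrix.fromBlocks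
      (Matrix.of fun a b : Fin (m + 1) => ∫ t in S y a, w μ t * t ^ (2 * (b : ℕ))) 0
      (Matrix.of fun a b => G a (Sum.inl b))
      (Matrix.of fun a b : Fin m => w μ (y a) * |y a| ^ (2 * (b : ℕ) + 1)) := by
    ext (a | a) (b | b)
    · simp only [hf, Matrix.of_apply, Sum.elim_inl, Matrix.fromBlocks_apply₁₁, eoE_inl]
      rw [integral_indicator (measurableSet_S y a)]
    · simp only [hf, Matrix.of_apply, Sum.elim_inl, Matrix.fromBlocks_apply₁₂, eoE_inr]
      rw [integral_indicator (measurableSet_S y a), odd_zero]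
      rfl
    · simp
    · simp only [hG, Matrix.of_apply, Sum.elim_inr, Matrix.fromBlocks_apply₂₂, eoE_inr]
      rw [pow_succ (sg _), pow_mul (sg _), sg_sq, one_pow, one_mul, pow_succ (y a),
        pow_succ |y a|, pow_mul |y a|, sq_abs, ← pow_mul, ← sg_mul (y a)]
      ring
  rw [h2, Matrix.det_fromBlocks_zero₁₂, det_inner μ y hy]
  ring

lemma gram (μ m : ℕ) :
    ∫ y in D m, (Matrix.of fun a b : Fin m => w μ (y a) * |y a| ^ (2 * (b : ℕ) + 1)).det ^ 2 =
      ∏ i ∈ Finset.range m, ((i.factorial : ℝ) * Real.Gamma ((i : ℝ) + μ + 3 / 2)) := by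
  have hg : ∀ a b : Fin m, ∀ t : ℝ, w μ t * |t| ^ (2 * (a : ℕ) + 1) *
      (w μ t * |t| ^ (2 * (b : ℕ) + 1)) =
      |t| ^ (2 * (μ + a + b) + 2) * Real.exp (-1 * t ^ 2) := by
    intro a b t
    rw [w, show -1 * t ^ 2 = -t ^ 2 / 2 + -t ^ 2 / 2 by ring, Real.exp_add]
    ring
  rw [andreief (fun (b : Fin m) t => w μ t * |t| ^ (2 * (b : ℕ) + 1))]
  · simp_rw [hg, integral_gauss one_pos]
    convert hankel m (μ + 3 / 2) (by positivity) using 2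
    · ext a b
      simp only [Matrix.of_apply, Real.one_rpow, one_mul]
      congr 1
      push_cast
      ring
    · congr 2
      ring
  · intro a b
    simp_rw [hg]
    exact integrable_gauss one_pos _

lemma main_integral (μ m : ℕ) : ∫ x, h μ (2 * m + 1) x =
    ((2 * m + 1).factorial : ℝ) * ((∫ t, w μ t) * 2 ^ m *
      ∏ i ∈ Finset.range m, ((i.factorial : ℝ) * Real.Gamma ((i : ℝ) + μ + 3 / 2))) := by
  rw [integral_h, ← integral_indicator (measurableSet_D _),
    integral_il _ ((integrable_K μ _).indicator (measurableSet_D _))]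
  simp_rw [inner_integral]
  rw [integral_indicator (measurableSet_D _), integral_const_mul, gram]

end GOE

/-- The expectation of `|det Q|^μ` for `Q ∈ GOE(2m+1)`, expressed via the joint
eigenvalue density `C₁(n) exp(-½∑λ²) ∏_{j<k} |λ_k - λ_j|` with
`C₁(n) = (2π)^{-n/2} ∏_{j=1}^n Γ(3/2)/Γ(1+j/2)`. -/
theorem goe_abs_det_moment (m μ : ℕ) (hμ : 1 ≤ μ) :
    (∫ lam : Fin (2 * m + 1) → ℝ,
        ((2 * π) ^ (-((2 * m + 1 : ℕ) : ℝ) / 2) *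
            ∏ j ∈ Finset.Icc 1 (2 * m + 1),
              Real.Gamma (3 / 2) / Real.Gamma (1 + (j : ℝ) / 2)) *
          (∏ i, |lam i|) ^ μ *
          Real.exp (-(∑ i, lam i ^ 2) / 2) *
          ∏ p ∈ Finset.univ.filter
              (fun p : Fin (2 * m + 1) × Fin (2 * m + 1) => p.1 < p.2),
            |lam p.2 - lam p.1|) =
      Real.Gamma (((μ : ℝ) + 1) / 2) * 2 ^ (((μ : ℝ) + 1) / 2) * (2 * π) ^ (-(1 : ℝ) / 2) *
        ∏ i ∈ Finset.range m,
          Real.Gamma ((i : ℝ) + μ + 3 / 2) / Real.Gamma ((i : ℝ) + 3 / 2) := by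
  have hint : ∀ lam : Fin (2 * m + 1) → ℝ,
      ((2 * π) ^ (-((2 * m + 1 : ℕ) : ℝ) / 2) *
            ∏ j ∈ Finset.Icc 1 (2 * m + 1),
              Real.Gamma (3 / 2) / Real.Gamma (1 + (j : ℝ) / 2)) *
          (∏ i, |lam i|) ^ μ *
          Real.exp (-(∑ i, lam i ^ 2) / 2) *
          ∏ p ∈ Finset.univ.filter
              (fun p : Fin (2 * m + 1) × Fin (2 * m + 1) => p.1 < p.2),
            |lam p.2 - lam p.1| =
      ((2 * π) ^ (-((2 * m + 1 : ℕ) : ℝ) / 2) *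
            ∏ j ∈ Finset.Icc 1 (2 * m + 1),
              Real.Gamma (3 / 2) / Real.Gamma (1 + (j : ℝ) / 2)) * GOE.h μ (2 * m + 1) lam := by
    intro lam
    rw [← GOE.h_eq]
    ring
  simp_rw [hint]
  rw [integral_const_mul, GOE.main_integral]
  have hT : ∫ t, GOE.w μ t = 2 ^ (((μ : ℝ) + 1) / 2) * Real.Gamma (((μ : ℝ) + 1) / 2) := by
    simpa using GOE.total μ 0
  have hc := GOE.const_identity m
  rw [hT]
  simp_rw [div_eq_mul_inv (Real.Gamma (_ + _ + _)), Finset.prod_mul_distrib]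
  linear_combination (2 ^ (((μ : ℝ) + 1) / 2) * Real.Gamma (((μ : ℝ) + 1) / 2) *
    ∏ i ∈ Finset.range m, Real.Gamma ((i : ℝ) + μ + 3 / 2)) * hc
end
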